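/- arXiv:1206.3971 — 2 statements merged into one kernel-verified Lean document; each statement's English description precedes it below -/
import Mathlib

section
/- Let (u_p)_{p>1} be any family of nodal solutions of (𝒫_p). Then for every ε > 0 there exists p_ε such that for all p ≥ p_ε one has p·(1/2 − 1/(p+1))·∫_{{x ∈ Ω : u_p(x) > 0}} |∇u_p(x)|² dx ≥ 4πe − ε, and likewise p·(1/2 − 1/(p+1))·∫_{{x ∈ Ω : u_p(x) < 0}} |∇u_p(x)|² dx ≥ 4πe − ε. -/
open MeasureTheory Real Set Filter Topology Metric

noncomputable section

/-- The Euclidean plane. -/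
abbrev R2 : Type := EuclideanSpace ℝ (Fin 2)

/-- The Laplacian: sum of the two pure second directional derivatives. -/
def lap (u : R2 → ℝ) (x : R2) : ℝ :=
  ∑ i : Fin 2,
    fderiv ℝ (fun y => fderiv ℝ u y (EuclideanSpace.single i 1)) x (EuclideanSpace.single i 1)

/-- Each point of ∂Ω has a neighborhood in which ∂Ω is the graph of a C^∞ function
(in suitable Euclidean coordinates). -/
def SmoothBoundary (Ω : Set R2) : Prop :=
  ∀ x ∈ frontier Ω, ∃ V : Set R2, IsOpen V ∧ x ∈ V ∧
    ∃ (e : R2 ≃ᵢ R2) (g : ℝ → ℝ), ContDiff ℝ (⊤ : ℕ∞) g ∧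
      frontier Ω ∩ V = {y | y ∈ V ∧ e y 1 = g (e y 0)}

/-- A (classical) solution of the Lane–Emden problem `(𝒫_p)` on Ω. -/
def IsSolution (Ω : Set R2) (p : ℝ) (u : R2 → ℝ) : Prop :=
  ContDiffOn ℝ 2 u Ω ∧ ContDiffOn ℝ 1 u (closure Ω) ∧
  (∀ x ∈ Ω, -lap u x = |u x| ^ (p - 1) * u x) ∧
  (∀ x ∈ frontier Ω, u x = 0)

/-- A nodal (sign-changing) function on Ω. -/
def IsNodal (Ω : Set R2) (u : R2 → ℝ) : Prop :=
  (∃ x ∈ Ω, 0 < u x) ∧ ∃ x ∈ Ω, u x < 0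

/-- The energy functional E_p. -/
def energy (Ω : Set R2) (p : ℝ) (u : R2 → ℝ) : ℝ :=
  (1 / 2) * ∫ x in Ω, ‖gradient u x‖ ^ 2 - (1 / (p + 1)) * ∫ x in Ω, |u x| ^ (p + 1)

/-- Condition (A): p·∫_Ω |∇u_p|² → 16πe. -/
def CondA (Ω : Set R2) (u : ℝ → R2 → ℝ) : Prop :=
  Tendsto (fun p : ℝ => p * ∫ x in Ω, ‖gradient (u p) x‖ ^ 2) atTop
    (𝓝 (16 * π * Real.exp 1))

/-- Condition (B): p·(u_p(x_p⁺) + u_p(x_p⁻)) → K for some K ≥ 0. -/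
def CondB (u : ℝ → R2 → ℝ) (xp xm : ℝ → R2) : Prop :=
  ∃ K : ℝ, 0 ≤ K ∧ Tendsto (fun p : ℝ => p * (u p (xp p) + u p (xm p))) atTop (𝓝 K)

/-- ε_p := (p·u_p(x_p⁺)^{p−1})^{−1/2}. -/
def eps (u : ℝ → R2 → ℝ) (xp : ℝ → R2) (p : ℝ) : ℝ :=
  1 / Real.sqrt (p * u p (xp p) ^ (p - 1))

/-- The rescaling z_p of u_p around x_p⁺. -/
def zp (u : ℝ → R2 → ℝ) (xp : ℝ → R2) (p : ℝ) (x : R2) : ℝ :=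
  (p / u p (xp p)) * (u p (eps u xp p • x + xp p) - u p (xp p))

/-- The rescaling z_p⁻ of u_p around x_p⁻ (with the scale ε_p of the maximum). -/
def zm (u : ℝ → R2 → ℝ) (xp xm : ℝ → R2) (p : ℝ) (x : R2) : ℝ :=
  (p / u p (xp p)) * (-u p (eps u xp p • x + xm p) - u p (xp p))

/-- Convergence in C²_loc(ℝ²) of a family of functions f_i defined on sets D_i:
every compact set K is eventually contained in D_i, and on K all derivatives up to
order 2 converge uniformly. -/
def TendstoC2loc {ι : Type} (l : Filter ι) (D : ι → Set R2) (f : ι → R2 → ℝ)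
    (g : R2 → ℝ) : Prop :=
  ∀ K : Set R2, IsCompact K →
    (∀ᶠ i in l, K ⊆ D i) ∧
    ∀ n : ℕ, n ≤ 2 →
      TendstoUniformlyOn (fun i x => iteratedFDeriv ℝ n (f i) x)
        (fun x => iteratedFDeriv ℝ n g x) l K

/-- The standard bubble U(x) = −2 log(1 + |x|²/8). -/
def stdBubble (x : R2) : ℝ := -2 * Real.log (1 + ‖x‖ ^ 2 / 8)

/-- The bubble U_μ(x) = log(μ/(1 + μ|x|²/8)²). -/
def bubble (μ : ℝ) (x : R2) : ℝ := Real.log (μ / (1 + μ * ‖x‖ ^ 2 / 8) ^ 2)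

/-- A C^∞ function compactly supported in S. -/
def CcSmoothIn (S : Set R2) (v : R2 → ℝ) : Prop :=
  ContDiff ℝ (⊤ : ℕ∞) v ∧ HasCompactSupport v ∧ tsupport v ⊆ S

/-- The quadratic form of the linearized operator at u. -/
def Qform (p : ℝ) (u v : R2 → ℝ) : ℝ :=
  ∫ x, (‖gradient v x‖ ^ 2 - p * |u x| ^ (p - 1) * v x ^ 2)

/-- Morse index one hypothesis (M): for p large, the quadratic form of the linearized
operator is negative somewhere on C_c^∞ of the positive nodal domain, but is not
negative definite on any 2-dimensional subspace. -/
def MorseOne (Ω : Set R2) (u : ℝ → R2 → ℝ) : Prop :=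
  ∀ᶠ p : ℝ in atTop,
    (∃ v : R2 → ℝ, CcSmoothIn {x ∈ Ω | 0 < u p x} v ∧ Qform p (u p) v < 0) ∧
    ¬ ∃ v w : R2 → ℝ, CcSmoothIn {x ∈ Ω | 0 < u p x} v ∧
        CcSmoothIn {x ∈ Ω | 0 < u p x} w ∧
        LinearIndependent ℝ ![v, w] ∧
        ∀ a b : ℝ, ¬(a = 0 ∧ b = 0) →
          Qform p (u p) (fun x => a * v x + b * w x) < 0

theorem integral_mul_lap {k w : R2 → ℝ} (hk : ContDiff ℝ 2 k) (hw : ContDiff ℝ 2 w)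
    (hc : HasCompactSupport w) :
    ∫ y, k y * lap w y = ∫ y, lap k y * w y := by
  have hd {f : R2 → ℝ} (hf : ContDiff ℝ 2 f) (v : R2) :
      ContDiff ℝ 1 (fun y => fderiv ℝ f y v) :=
    (hf.fderiv_right (m := 1) (by norm_num)).clm_apply contDiff_const
  have hdd {f : R2 → ℝ} (hf : ContDiff ℝ 1 f) (v : R2) :
      Continuous (fun y => fderiv ℝ f y v) :=
    (hf.continuous_fderiv (by norm_num)).clm_apply continuous_const
  have hcd {f : R2 → ℝ} (hf : HasCompactSupport f) (v : R2) :
      HasCompactSupport (fun y => fderiv ℝ f y v) := hf.fderiv_apply (𝕜 := ℝ) v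
  have hi {f g : R2 → ℝ} (hf : Continuous f) (hg : Continuous g) (hgc : HasCompactSupport g) :
      Integrable (fun y => f y * g y) :=
    (hf.mul hg).integrable_of_hasCompactSupport hgc.mul_left
  have main (v : R2) :
      ∫ y, k y * fderiv ℝ (fun z => fderiv ℝ w z v) y v =
        ∫ y, fderiv ℝ (fun z => fderiv ℝ k z v) y v * w y := by
    rw [integral_mul_fderiv_eq_neg_fderiv_mul_of_integrable
      (hi (hdd (hk.of_le (by norm_num)) v) (hd hw v).continuous (hcd hc v))
      (hi hk.continuous (hdd (hd hw v) v) (hcd (hcd hc v) v))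
      (hi hk.continuous (hd hw v).continuous (hcd hc v))
      (fun x _ => hk.differentiable (by norm_num) x)
      (fun x _ => (hd hw v).differentiable (by norm_num) x),
      integral_mul_fderiv_eq_neg_fderiv_mul_of_integrable
      (hi (hdd (hd hk v) v) hw.continuous hc)
      (hi (hd hk v).continuous (hdd (hw.of_le (by norm_num)) v) (hcd hc v))
      (hi (hd hk v).continuous hw.continuous hc)
      (fun x _ => (hd hk v).differentiable (by norm_num) x)
      (fun x _ => hw.differentiable (by norm_num) x), neg_neg]
  simp only [lap, Finset.mul_sum, Finset.sum_mul]
  rw [integral_finsetSum _ fun i _ => hi hk.continuous (hdd (hd hw _) _) (hcd (hcd hc _) _),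
    integral_finsetSum _ fun i _ => hi (hdd (hd hk _) _) hw.continuous hc]
  exact Finset.sum_congr rfl fun i _ => main _

theorem contDiff_log_norm_sq_add (x : R2) {a : ℝ} (ha : 0 < a) {n : WithTop ℕ∞} :
    ContDiff ℝ n (fun y : R2 => Real.log (‖x - y‖ ^ 2 + a)) :=
  (((contDiff_const.sub contDiff_id).norm_sq ℝ).add contDiff_const).log
    fun y => by positivity

theorem lap_log_norm_sq_add (x : R2) {a : ℝ} (ha : 0 < a) (y : R2) :
    lap (fun y : R2 => Real.log (‖x - y‖ ^ 2 + a)) y = 4 * a / (‖x - y‖ ^ 2 + a) ^ 2 := by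
  have hpos (z : R2) : 0 < ‖x - z‖ ^ 2 + a := by positivity
  have hN (z : R2) : HasFDerivAt (fun y : R2 => ‖x - y‖ ^ 2 + a)
      (2 • (innerSL ℝ (x - z)).comp (-ContinuousLinearMap.id ℝ R2)) z :=
    (((hasFDerivAt_id z).const_sub x).norm_sq).add_const a
  have h1 (i : Fin 2) (z : R2) : fderiv ℝ (fun y : R2 => Real.log (‖x - y‖ ^ 2 + a)) z
      (EuclideanSpace.single i 1) = -(2 * (x i - z i)) / (‖x - z‖ ^ 2 + a) := by
    rw [((hN z).log (hpos z).ne').fderiv]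
    simp [EuclideanSpace.inner_single_right]
    ring
  have h2 (i : Fin 2) : HasFDerivAt (fun z : R2 => -(2 * (x i - z i)))
      ((2 : ℝ) • (EuclideanSpace.proj i : R2 →L[ℝ] ℝ)) y := by
    have := (((EuclideanSpace.proj i : R2 →L[ℝ] ℝ).hasFDerivAt (x := y)).const_sub (x i)).const_mul
      (-2 : ℝ)
    have e : (2 : ℝ) • (EuclideanSpace.proj i : R2 →L[ℝ] ℝ) =
        (-2 : ℝ) • -(EuclideanSpace.proj i : R2 →L[ℝ] ℝ) := by ext; simp
    rw [e]
    exact this.congr_of_eventuallyEq (.of_forall fun z => by simp)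
  have h3 (i : Fin 2) : fderiv ℝ (fun z : R2 => -(2 * (x i - z i)) / (‖x - z‖ ^ 2 + a)) y
      (EuclideanSpace.single i 1) =
      2 / (‖x - y‖ ^ 2 + a) - 4 * (x i - y i) ^ 2 / (‖x - y‖ ^ 2 + a) ^ 2 := by
    have := (h2 i).mul ((hasDerivAt_inv (hpos y).ne').comp_hasFDerivAt y (hN y))
    simp only [div_eq_mul_inv]
    have e := this.fderiv
    simp only [Function.comp_def] at e
    erw [e]
    simp [EuclideanSpace.inner_single_right]
    field_simp
    ring
  have hn : ‖x - y‖ ^ 2 = (x 0 - y 0) ^ 2 + (x 1 - y 1) ^ 2 := by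
    simp [EuclideanSpace.real_norm_sq_eq]
  simp only [lap, h1, h3, Fin.sum_univ_two]
  have := (hpos y).ne'
  field_simp
  rw [hn]
  ring

theorem volume_real_unit_ball_R2 : (volume : Measure R2).real (ball 0 1) = π := by
  simp [Measure.real, EuclideanSpace.volume_ball, one_add_one_eq_two,
    Real.sq_sqrt pi_nonneg, pi_nonneg]

theorem integral_poisson_kernel :
    ∫ z : R2, 1 / (π * (1 + ‖z‖ ^ 2) ^ 2) = 1 := by
  rw [integral_fun_norm_addHaar volume (fun r : ℝ => 1 / (π * (1 + r ^ 2) ^ 2)),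
    volume_real_unit_ball_R2]
  have hd : ∀ r ∈ Ici (0 : ℝ), HasDerivAt (fun r : ℝ => -(1 / (2 * π)) * (1 + r ^ 2)⁻¹)
      (r ^ (Module.finrank ℝ R2 - 1) • (1 / (π * (1 + r ^ 2) ^ 2))) r := by
    intro r _
    have hr : 1 + r ^ 2 ≠ 0 := by positivity
    have := (((hasDerivAt_pow 2 r).const_add 1).inv hr).const_mul (-(1 / (2 * π)))
    have e : r ^ (Module.finrank ℝ R2 - 1) • (1 / (π * (1 + r ^ 2) ^ 2)) =
        -(1 / (2 * π)) * (-((2 : ℕ) * r ^ (2 - 1)) / (1 + r ^ 2) ^ 2) := by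
      simp
      field_simp
    rw [e]
    exact this
  have hlim : Tendsto (fun r : ℝ => -(1 / (2 * π)) * (1 + r ^ 2)⁻¹) atTop (𝓝 0) := by
    have : Tendsto (fun r : ℝ => (1 + r ^ 2)⁻¹) atTop (𝓝 0) :=
      (tendsto_atTop_add_const_left _ _ (tendsto_pow_atTop (by norm_num))).inv_tendsto_atTop
    simpa using this.const_mul (-(1 / (2 * π)))
  rw [integral_Ioi_of_hasDerivAt_of_nonneg' hd (fun r hr => ?_) hlim]
  · simp
  · have : (0 : ℝ) < r := hr
    simp only [smul_eq_mul]
    positivity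

theorem tendsto_integral_log_mul_lap {w : R2 → ℝ} (hw : ContDiff ℝ 2 w)
    (hc : HasCompactSupport w) (x : R2) :
    Tendsto (fun c : ℝ => ∫ y, Real.log (‖x - y‖ ^ 2 + (c ^ 2)⁻¹) * lap w y) atTop
      (𝓝 (4 * π * w x)) := by
  have hlim : Tendsto (fun z : R2 => ‖z‖ ^ Module.finrank ℝ R2 * (1 / (π * (1 + ‖z‖ ^ 2) ^ 2)))
      (Bornology.cobounded R2) (𝓝 0) := by
    have h0 : Tendsto (fun z : R2 => (π * (1 + ‖z‖ ^ 2))⁻¹) (Bornology.cobounded R2) (𝓝 0) :=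
      (((tendsto_atTop_add_const_left _ _ ((tendsto_pow_atTop two_ne_zero).comp
        tendsto_norm_cobounded_atTop))).const_mul_atTop pi_pos).inv_tendsto_atTop
    refine squeeze_zero (fun z => by positivity) (fun z => ?_) h0
    simp only [finrank_euclideanSpace, Fintype.card_fin]
    rw [mul_one_div, div_le_iff₀ (by positivity)]
    field_simp
    linarith
  have key := (tendsto_integral_comp_smul_smul_of_integrable' (μ := (volume : Measure R2))
    (fun z => by positivity) integral_poisson_kernel hlim
    (hw.continuous.integrable_of_hasCompactSupport hc)
    (hw.continuous.continuousAt (x := x))).const_mul (4 * π)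
  refine key.congr' ?_
  filter_upwards [eventually_gt_atTop 0] with c hc0
  rw [integral_mul_lap (contDiff_log_norm_sq_add x (by positivity)) hw hc, ← integral_const_mul]
  congr 1 with y
  rw [lap_log_norm_sq_add x (by positivity)]
  simp only [finrank_euclideanSpace, Fintype.card_fin, norm_smul, smul_eq_mul,
    Real.norm_of_nonneg hc0.le]
  field_simp
  ring

theorem exists_primitive_eq_zero {g : ℝ → ℝ} {n : ℕ} (hg : ContDiff ℝ n g) {δ : ℝ}
    (h0 : ∀ t ≤ δ, g t = 0) :
    ∃ G : ℝ → ℝ, ContDiff ℝ (n + 1) G ∧ (∀ t ≤ δ, G t = 0) ∧ deriv G = g := by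
  have hd (t : ℝ) : HasDerivAt (fun t => ∫ s in δ..t, g s) (g t) t :=
    hg.continuous.integral_hasStrictDerivAt δ t |>.hasDerivAt
  have hd' : deriv (fun t => ∫ s in δ..t, g s) = g := funext fun t => (hd t).deriv
  refine ⟨fun t => ∫ s in δ..t, g s, ?_, fun t ht => ?_, hd'⟩
  · rw [contDiff_succ_iff_deriv]
    exact ⟨fun t => (hd t).differentiableAt, by simp, by rwa [hd']⟩
  · refine intervalIntegral.integral_zero_ae (.of_forall fun s hs => h0 s ?_)
    rw [uIoc_of_ge ht] at hs
    exact hs.2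

theorem exists_smooth_positive_part {δ : ℝ} (hδ : 0 < δ) :
    ∃ φ : ℝ → ℝ, ContDiff ℝ 2 φ ∧ (∀ t ≤ δ, φ t = 0) ∧
      (∀ t, 0 ≤ deriv φ t) ∧ (∀ t, deriv φ t ≤ 1) ∧ (∀ t, 0 ≤ deriv (deriv φ) t) ∧
        (∀ t, t - 2 * δ ≤ φ t) := by
  obtain ⟨φ, hφ, h0, hd⟩ := exists_primitive_eq_zero (n := 1) (δ := δ)
    (g := fun t => smoothTransition (t / δ - 1))
    (smoothTransition.contDiff.comp ((contDiff_id.div_const δ).sub contDiff_const))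
    (fun t ht => smoothTransition.zero_of_nonpos (by
      rw [sub_nonpos, div_le_one hδ]; exact ht))
  have hdiff : Differentiable ℝ φ := hφ.differentiable (by norm_num)
  have hnonneg (t : ℝ) : 0 ≤ deriv φ t := by rw [hd]; exact smoothTransition.nonneg _
  refine ⟨φ, by simpa [one_add_one_eq_two] using hφ, h0, hnonneg, fun t => ?_,
    fun t => ?_, fun t => ?_⟩
  · rw [hd]
    exact smoothTransition.le_one _
  · rw [hd]
    refine Monotone.deriv_nonneg fun a b hab => smoothTransition.monotone ?_
    gcongr
  · have hmono : Monotone φ := monotone_of_deriv_nonneg hdiff hnonneg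
    have hφ0 : 0 ≤ φ (2 * δ) := (h0 δ le_rfl).symm.le.trans (hmono (by linarith))
    rcases le_total t (2 * δ) with ht | ht
    · rcases le_total t δ with ht' | ht'
      · rw [h0 t ht']; linarith
      · have := hmono ht'
        rw [h0 δ le_rfl] at this
        linarith
    · have : MonotoneOn (fun t => φ t - t) (Ici (2 * δ)) := by
        refine monotoneOn_of_deriv_nonneg (convex_Ici _)
          (hdiff.continuous.sub continuous_id).continuousOn
          (hdiff.sub differentiable_id).differentiableOn fun x hx => ?_
        rw [interior_Ici] at hx
        have hx : 2 * δ < x := hx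
        rw [deriv_fun_sub (hdiff x) differentiableAt_fun_id, hd, deriv_id'']
        beta_reduce
        rw [smoothTransition.one_of_one_le, sub_self]
        rw [le_sub_iff_add_le, le_div_iff₀ hδ]
        linarith
      have := this self_mem_Ici ht ht
      simp only at this
      linarith

theorem norm_gradient_sq (u : R2 → ℝ) (x : R2) :
    ‖gradient u x‖ ^ 2 = ∑ i : Fin 2, fderiv ℝ u x (EuclideanSpace.single i 1) ^ 2 := by
  rw [EuclideanSpace.real_norm_sq_eq]
  refine Finset.sum_congr rfl fun i _ => ?_
  congr 1
  rw [← InnerProductSpace.toDual_symm_apply (𝕜 := ℝ) (y := fderiv ℝ u x),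
    EuclideanSpace.inner_single_right]
  simp [gradient]

theorem lap_congr {f g : R2 → ℝ} {x : R2} (h : f =ᶠ[𝓝 x] g) : lap f x = lap g x := by
  refine Finset.sum_congr rfl fun i _ => ?_
  have : (fun y => fderiv ℝ f y (EuclideanSpace.single i 1)) =ᶠ[𝓝 x]
      fun y => fderiv ℝ g y (EuclideanSpace.single i 1) :=
    (h.fderiv (𝕜 := ℝ)).mono fun y hy => by simp only [hy]
  rw [this.fderiv_eq]

theorem lap_comp {F : ℝ → ℝ} {u : R2 → ℝ} {x : R2} (hF : ContDiff ℝ 2 F)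
    (hu : ContDiffAt ℝ 2 u x) :
    lap (fun y => F (u y)) x =
      deriv (deriv F) (u x) * ‖gradient u x‖ ^ 2 + deriv F (u x) * lap u x := by
  have hF1 : ContDiff ℝ 1 (deriv F) := ((contDiff_succ_iff_deriv (n := 1)).1 hF).2.2
  have hd : ∀ᶠ y in 𝓝 x, DifferentiableAt ℝ u y :=
    (hu.eventually (by simp)).mono fun y hy => hy.differentiableAt (by norm_num)
  rw [norm_gradient_sq, lap, lap, Finset.mul_sum, Finset.mul_sum, ← Finset.sum_add_distrib]
  refine Finset.sum_congr rfl fun i _ => ?_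
  set e : R2 := EuclideanSpace.single i 1
  have h1 : (fun y => fderiv ℝ (fun y => F (u y)) y e) =ᶠ[𝓝 x]
      fun y => deriv F (u y) * fderiv ℝ u y e := by
    filter_upwards [hd] with y hy
    have := ((hF.differentiable (by norm_num) (u y)).hasDerivAt.comp_hasFDerivAt y
      hy.hasFDerivAt).fderiv
    simp only [Function.comp_def] at this
    simp [this]
  have h2 : DifferentiableAt ℝ (fun y => fderiv ℝ u y e) x :=
    ((hu.fderiv_right (m := 1) (by norm_num)).clm_apply contDiffAt_const).differentiableAt
      (by norm_num)
  have h3 := ((hF1.differentiable (by norm_num) (u x)).hasDerivAt.comp_hasFDerivAt x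
      hd.self_of_nhds.hasFDerivAt).mul h2.hasFDerivAt
  have h4 := h3.fderiv
  rw [h1.fderiv_eq]
  change fderiv ℝ (fun y => deriv F (u y) * fderiv ℝ u y e) x = _ at h4
  rw [h4]
  simp
  ring

section Truncation

variable {Ω : Set R2} {u : R2 → ℝ} {F : ℝ → ℝ} {c : ℝ}

theorem isCompact_superlevel (hbdd : Bornology.IsBounded Ω) (hu : ContinuousOn u (closure Ω)) :
    IsCompact (closure Ω ∩ u ⁻¹' Ici c) :=
  hbdd.isCompact_closure.of_isClosed_subset (hu.preimage_isClosed_of_isClosed isClosed_closure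
    isClosed_Ici) inter_subset_left

theorem superlevel_subset (hop : IsOpen Ω) (hc : 0 < c) (hfr : ∀ x ∈ frontier Ω, u x = 0) :
    closure Ω ∩ u ⁻¹' Ici c ⊆ Ω := by
  rintro x ⟨hx, hxc⟩
  by_contra hn
  have := hfr x ⟨hx, by rwa [hop.interior_eq]⟩
  have hxc : c ≤ u x := hxc
  linarith

theorem indicator_comp_eq_zero (hF : ∀ t ≤ c, F t = 0) {x : R2}
    (hx : x ∉ closure Ω ∩ u ⁻¹' Ici c) : Ω.indicator (fun y => F (u y)) x = 0 := by
  by_cases hxΩ : x ∈ Ω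
  · rw [indicator_of_mem hxΩ]
    exact hF _ (not_le.1 fun h => hx ⟨subset_closure hxΩ, h⟩).le
  · exact indicator_of_notMem hxΩ _

theorem hasCompactSupport_indicator_comp (hbdd : Bornology.IsBounded Ω)
    (hu : ContinuousOn u (closure Ω)) (hF : ∀ t ≤ c, F t = 0) :
    HasCompactSupport (Ω.indicator fun y => F (u y)) :=
  HasCompactSupport.intro (isCompact_superlevel hbdd hu) fun _ hx => indicator_comp_eq_zero hF hx

theorem contDiff_indicator_comp (hop : IsOpen Ω) (hbdd : Bornology.IsBounded Ω)
    (hu2 : ContDiffOn ℝ 2 u Ω) (hu : ContinuousOn u (closure Ω)) (hfr : ∀ x ∈ frontier Ω, u x = 0)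
    (hc : 0 < c) (hF2 : ContDiff ℝ 2 F) (hF : ∀ t ≤ c, F t = 0) :
    ContDiff ℝ 2 (Ω.indicator fun y => F (u y)) := by
  rw [contDiff_iff_contDiffAt]
  intro x
  by_cases hx : x ∈ Ω
  · refine (hF2.contDiffAt.comp x (hu2.contDiffAt (hop.mem_nhds hx))).congr_of_eventuallyEq ?_
    filter_upwards [hop.mem_nhds hx] with y hy
    simp [hy]
  · have hK := (isCompact_superlevel (c := c) hbdd hu).isClosed.isOpen_compl
    refine (contDiffAt_const (c := (0 : ℝ))).congr_of_eventuallyEq ?_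
    filter_upwards [hK.mem_nhds fun h => hx (superlevel_subset hop hc hfr h)] with y hy
    exact indicator_comp_eq_zero hF hy

theorem lap_indicator_comp (hop : IsOpen Ω) (hbdd : Bornology.IsBounded Ω)
    (hu2 : ContDiffOn ℝ 2 u Ω) (hu : ContinuousOn u (closure Ω)) (hfr : ∀ x ∈ frontier Ω, u x = 0)
    (hc : 0 < c) (hF2 : ContDiff ℝ 2 F) (hF : ∀ t ≤ c, F t = 0) (x : R2) :
    lap (Ω.indicator fun y => F (u y)) x = {x ∈ Ω | 0 < u x}.indicator (fun x =>
      deriv (deriv F) (u x) * ‖gradient u x‖ ^ 2 + deriv F (u x) * lap u x) x := by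
  by_cases hx : x ∈ closure Ω ∩ u ⁻¹' Ici c
  · have hxΩ := superlevel_subset hop hc hfr hx
    rw [indicator_of_mem (show x ∈ {x ∈ Ω | 0 < u x} from ⟨hxΩ, hc.trans_le hx.2⟩),
      ← lap_comp hF2 (hu2.contDiffAt (hop.mem_nhds hxΩ))]
    refine lap_congr ?_
    filter_upwards [hop.mem_nhds hxΩ] with y hy
    simp [hy]
  · have hK := (isCompact_superlevel (c := c) hbdd hu).isClosed.isOpen_compl
    have h0 : Ω.indicator (fun y => F (u y)) =ᶠ[𝓝 x] fun _ => (0 : ℝ) := by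
      filter_upwards [hK.mem_nhds hx] with y hy
      exact indicator_comp_eq_zero hF hy
    rw [lap_congr h0]
    have : lap (fun _ => (0 : ℝ)) x = 0 := by simp [lap]
    rw [this, eq_comm, indicator_apply_eq_zero]
    rintro ⟨hxΩ, -⟩
    have hlt : u x < c := not_le.1 fun h => hx ⟨subset_closure hxΩ, h⟩
    have h1 : F =ᶠ[𝓝 (u x)] fun _ => (0 : ℝ) := by
      filter_upwards [Iio_mem_nhds hlt] with t ht using hF t (le_of_lt ht)
    rw [h1.deriv.deriv_eq, h1.deriv_eq]
    simp

end Truncation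

theorem exists_norm_gradient_le {Ω : Set R2} {u : R2 → ℝ} (hop : IsOpen Ω)
    (hbdd : Bornology.IsBounded Ω) (hu : ContDiffOn ℝ 1 u (closure Ω)) :
    ∃ C, ∀ x ∈ Ω, ‖gradient u x‖ ≤ C := by
  have hg (x : R2) : ‖gradient u x‖ = ‖fderiv ℝ u x‖ := LinearIsometryEquiv.norm_map _ _
  simp only [hg]
  have : ∃ C, ∀ x ∈ closure Ω, x ∈ Ω → ‖fderiv ℝ u x‖ ≤ C := by
    refine hbdd.isCompact_closure.induction_on
      (p := fun s => ∃ C, ∀ x ∈ s, x ∈ Ω → ‖fderiv ℝ u x‖ ≤ C)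
      ⟨0, by simp⟩ (fun s t hst ⟨C, hC⟩ => ⟨C, fun x hx => hC x (hst hx)⟩) ?_ ?_
    · rintro s t ⟨C, hC⟩ ⟨D, hD⟩
      refine ⟨max C D, fun x hx hxΩ => ?_⟩
      rcases hx with hx | hx
      · exact (hC x hx hxΩ).trans (le_max_left _ _)
      · exact (hD x hx hxΩ).trans (le_max_right _ _)
    · intro x hx
      obtain ⟨w, hw, -, f', hf', hcont⟩ :=
        (contDiffWithinAt_succ_iff_hasFDerivWithinAt (n := 0) (by simp)).1 (by simpa using hu x hx)
      rw [insert_eq_of_mem hx] at hw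
      have hwΩ : w ∈ 𝓝[Ω] x := nhdsWithin_mono x subset_closure hw
      have hb : ∀ᶠ y in 𝓝[w] x, ‖f' y‖ < ‖f' x‖ + 1 :=
        hcont.continuousWithinAt.norm.eventually_lt_const (lt_add_one _)
      have hb' : ∀ᶠ y in 𝓝[Ω] x, y ∈ w → ‖f' y‖ < ‖f' x‖ + 1 := by
        rw [eventually_nhdsWithin_iff] at hb
        exact nhdsWithin_le_nhds hb
      have hww : ∀ᶠ y in 𝓝[Ω] x, w ∈ 𝓝[Ω] y := eventually_eventually_nhdsWithin.2 hwΩ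
      have key : ∀ᶠ y in 𝓝[Ω] x, y ∈ Ω → ‖fderiv ℝ u y‖ ≤ ‖f' x‖ + 1 := by
        filter_upwards [hb', hww] with y h1 h2 hy
        rw [hop.nhdsWithin_eq hy] at h2
        rw [((hf' y (mem_of_mem_nhds h2)).hasFDerivAt h2).fderiv]
        exact (h1 (mem_of_mem_nhds h2)).le
      rw [eventually_nhdsWithin_iff] at key
      exact ⟨_, nhdsWithin_le_nhds key, ‖f' x‖ + 1, fun y hy hyΩ => hy hyΩ hyΩ⟩
  obtain ⟨C, hC⟩ := this
  exact ⟨C, fun x hx => hC x (subset_closure hx) hx⟩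

theorem integrableOn_of_norm_le {G : Set R2} (hG : IsOpen G) (hb : Bornology.IsBounded G)
    {g : R2 → ℝ} (hg : ContinuousOn g G) {C : ℝ} (hC : ∀ x ∈ G, ‖g x‖ ≤ C) :
    IntegrableOn g G :=
  haveI : IsFiniteMeasure (volume.restrict G) := ⟨by simpa using hb.measure_lt_top⟩
  Integrable.of_bound (hg.aestronglyMeasurable hG.measurableSet) C
    ((ae_restrict_iff' hG.measurableSet).2 (.of_forall hC))

/-- A form of Jensen's inequality for the entropy of the density `u ^ p / ∫ u ^ p`. -/
theorem setIntegral_rpow_mul_log_le {G : Set R2} (hG : MeasurableSet G) {u h : R2 → ℝ} {p : ℝ}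
    (hp : 0 ≤ p) (hu : ∀ x ∈ G, 0 < u x) (hh : ∀ x ∈ G, 0 < h x)
    (hM : 0 < ∫ x in G, u x ^ p) (hE : 0 < ∫ x in G, u x ^ (p + 1))
    (hgint : IntegrableOn h G) (hlog : IntegrableOn (fun x => u x ^ p * Real.log (h x)) G) :
    ∫ x in G, u x ^ p * Real.log (h x) ≤
      (∫ x in G, u x ^ p) * (p * Real.log ((∫ x in G, u x ^ (p + 1)) / ∫ x in G, u x ^ p)
        - Real.log (∫ x in G, u x ^ p) + (∫ x in G, h x) - 1) := by
  set M := ∫ x in G, u x ^ p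
  set E := ∫ x in G, u x ^ (p + 1)
  have hm : 0 < E / M := div_pos hE hM
  have hfi : IntegrableOn (fun x => u x ^ p) G := not_imp_comm.1 integral_undef hM.ne'
  have hfi' : IntegrableOn (fun x => u x ^ (p + 1)) G := not_imp_comm.1 integral_undef hE.ne'
  have hpt (x) (hx : x ∈ G) : u x ^ p * Real.log (h x) ≤
      M * h x + (p * Real.log (E / M) - p - Real.log M - 1) * u x ^ p
        + p * (E / M)⁻¹ * u x ^ (p + 1) := by
    have hux := hu x hx
    have hf : 0 < u x ^ p := rpow_pos_of_pos hux p
    have h1 := log_le_sub_one_of_pos (div_pos (mul_pos (hh x hx) hM) hf)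
    have h2 := log_le_sub_one_of_pos (div_pos hux hm)
    rw [Real.log_div (mul_pos (hh x hx) hM).ne' hf.ne', Real.log_mul (hh x hx).ne' hM.ne',
      Real.log_rpow hux] at h1
    rw [Real.log_div hux.ne' hm.ne'] at h2
    rw [rpow_add_one hux.ne']
    have h3 := mul_le_mul_of_nonneg_left h2 hp
    have h4 : u x ^ p * (Real.log (h x) + Real.log M - p * Real.log (E / M)) ≤
        u x ^ p * (h x * M / u x ^ p - 1 + p * (u x / (E / M) - 1)) :=
      mul_le_mul_of_nonneg_left (by linarith) hf.le
    have h5 : u x ^ p * (h x * M / u x ^ p) = h x * M := by field_simp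
    have h6 : u x / (E / M) = (E / M)⁻¹ * u x := by rw [div_eq_inv_mul]
    rw [h6] at h4
    linarith
  have hi1 : IntegrableOn (fun x => M * h x) G := hgint.const_mul M
  have hi2 : IntegrableOn (fun x =>
    (p * Real.log (E / M) - p - Real.log M - 1) * u x ^ p) G := hfi.const_mul _
  have hi3 : IntegrableOn (fun x => p * (E / M)⁻¹ * u x ^ (p + 1)) G := hfi'.const_mul _
  have hi12 : IntegrableOn (fun x => M * h x +
    (p * Real.log (E / M) - p - Real.log M - 1) * u x ^ p) G := hi1.add hi2
  refine (setIntegral_mono_on hlog (hi12.add hi3) hG hpt).trans_eq ?_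
  simp only [Pi.add_apply]
  rw [integral_add hi12 hi3, integral_add hi1 hi2, integral_const_mul, integral_const_mul,
    integral_const_mul]
  change M * _ + _ * M + _ * E = _
  field_simp
  ring

theorem exists_setIntegral_rpow_le {s R : ℝ} (hs0 : 0 < s) (hs : s < 1) :
    ∃ C, ∀ (x : R2) (G : Set R2), MeasurableSet G → G ⊆ ball x R → ∀ a > 0,
      ∫ y in G, (‖x - y‖ ^ 2 + a) ^ (-s) ≤ C := by
  set f : R2 → ℝ := (ball 0 R).indicator fun z => ‖z‖ ^ (-(2 * s))
  have hf : Integrable f := by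
    rw [integrable_indicator_iff measurableSet_ball]
    refine integrableOn_ball_of_norm_le_rpow (C := 1) (α := 2 * s) (by simp) ?_
      (.of_forall fun z => ?_)
      (measurable_norm.pow_const _).aestronglyMeasurable
    · simp; linarith
    · rw [Real.norm_of_nonneg (by positivity), one_mul]
  refine ⟨∫ z, f z, fun x G hG hGR a ha => ?_⟩
  rw [← integral_indicator hG, ← integral_sub_left_eq_self f volume x]
  refine integral_mono_of_nonneg (.of_forall fun y => indicator_nonneg (fun y _ => by positivity) y)
    (hf.comp_sub_left x) ?_
  have hne : ∀ᵐ y : R2, y ≠ x := by simp [ae_iff]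
  filter_upwards [hne] with y hy
  by_cases hyG : y ∈ G
  · have hyb : x - y ∈ ball (0 : R2) R := by
      simpa [dist_eq_norm, norm_sub_rev] using hGR hyG
    simp only [f]
    rw [indicator_of_mem hyG, indicator_of_mem hyb]
    have hpos : 0 < ‖x - y‖ := norm_pos_iff.2 (sub_ne_zero.2 hy.symm)
    have : ‖x - y‖ ^ (-(2 * s)) = (‖x - y‖ ^ 2) ^ (-s) := by
      rw [← rpow_natCast, ← rpow_mul hpos.le]
      norm_num
    rw [this]
    exact rpow_le_rpow_of_nonpos (by positivity) (by linarith) (by linarith)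
  · rw [indicator_of_notMem hyG]
    exact indicator_nonneg (fun z _ => by positivity) _

section PositivePart

variable {Ω : Set R2} {p : ℝ} {u : R2 → ℝ}

theorem IsSolution.isOpen_pos (hop : IsOpen Ω) (hsol : IsSolution Ω p u) :
    IsOpen {x ∈ Ω | 0 < u x} :=
  hsol.1.continuousOn.isOpen_inter_preimage hop isOpen_Ioi

theorem IsSolution.exists_norm_le (hbdd : Bornology.IsBounded Ω) (hsol : IsSolution Ω p u) :
    ∃ U, ∀ x ∈ Ω, ‖u x‖ ≤ U := by
  obtain ⟨U, hU⟩ := hbdd.isCompact_closure.exists_bound_of_continuousOn hsol.2.1.continuousOn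
  exact ⟨U, fun x hx => hU x (subset_closure hx)⟩

theorem IsSolution.continuousOn_rpow (hsol : IsSolution Ω p u) (q : ℝ) :
    ContinuousOn (fun x => u x ^ q) {x ∈ Ω | 0 < u x} :=
  (hsol.1.continuousOn.mono (sep_subset _ _)).rpow_const fun _ hx => .inl hx.2.ne'

theorem IsSolution.integrableOn_rpow_mul (hop : IsOpen Ω) (hbdd : Bornology.IsBounded Ω)
    (hsol : IsSolution Ω p u) {q : ℝ} (hq : 0 ≤ q) {g : R2 → ℝ}
    (hg : ContinuousOn g {x ∈ Ω | 0 < u x}) {C : ℝ} (hC : ∀ x ∈ {x ∈ Ω | 0 < u x}, ‖g x‖ ≤ C) :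
    IntegrableOn (fun x => u x ^ q * g x) {x ∈ Ω | 0 < u x} := by
  obtain ⟨U, hU⟩ := hsol.exists_norm_le hbdd
  refine integrableOn_of_norm_le (hsol.isOpen_pos hop) (hbdd.subset (sep_subset _ _))
    ((hsol.continuousOn_rpow q).mul hg) (C := U ^ q * C) fun x hx => ?_
  have hx0 : 0 < u x := hx.2
  rw [norm_mul, Real.norm_of_nonneg (rpow_nonneg hx0.le q)]
  have hUx : u x ≤ U := (le_abs_self _).trans (hU x hx.1)
  exact mul_le_mul (rpow_le_rpow hx0.le hUx hq) (hC x hx) (norm_nonneg _)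
    (rpow_nonneg (hx0.le.trans hUx) q)

theorem IsSolution.integrableOn_rpow (hop : IsOpen Ω) (hbdd : Bornology.IsBounded Ω)
    (hsol : IsSolution Ω p u) {q : ℝ} (hq : 0 ≤ q) :
    IntegrableOn (fun x => u x ^ q) {x ∈ Ω | 0 < u x} := by
  simpa using hsol.integrableOn_rpow_mul hop hbdd hq (g := fun _ => 1) continuousOn_const
    (C := 1) (by simp)

theorem IsSolution.setIntegral_rpow_pos (hop : IsOpen Ω) (hbdd : Bornology.IsBounded Ω)
    (hsol : IsSolution Ω p u) (hpos : ∃ x ∈ Ω, 0 < u x) {q : ℝ} (hq : 0 ≤ q) :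
    0 < ∫ x in {x ∈ Ω | 0 < u x}, u x ^ q := by
  have hG := hsol.isOpen_pos hop
  rw [setIntegral_pos_iff_support_of_nonneg_ae
    ((ae_restrict_iff' hG.measurableSet).2 (.of_forall fun x hx => rpow_nonneg hx.2.le q))
    (hsol.integrableOn_rpow hop hbdd hq)]
  refine (hG.measure_pos volume hpos).trans_le (measure_mono fun x hx => ⟨?_, hx⟩)
  exact (rpow_pos_of_pos hx.2 q).ne'

theorem IsSolution.lap_eq (hsol : IsSolution Ω p u) {x : R2} (hx : x ∈ {x ∈ Ω | 0 < u x}) :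
    lap u x = -u x ^ p := by
  have h := hsol.2.2.1 x hx.1
  have hx0 : 0 < u x := hx.2
  rw [abs_of_pos hx0, ← rpow_add_one hx0.ne', sub_add_cancel] at h
  linarith

theorem IsSolution.integrableOn_gradient (hop : IsOpen Ω) (hbdd : Bornology.IsBounded Ω)
    (hsol : IsSolution Ω p u) :
    IntegrableOn (fun x => ‖gradient u x‖ ^ 2) {x ∈ Ω | 0 < u x} := by
  obtain ⟨C, hC⟩ := exists_norm_gradient_le hop hbdd hsol.2.1
  have hcont : ContinuousOn (gradient u) Ω :=
    (LinearIsometryEquiv.continuous _).comp_continuousOn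
      (hsol.1.continuousOn_fderiv_of_isOpen hop (by norm_num))
  refine integrableOn_of_norm_le (hsol.isOpen_pos hop) (hbdd.subset (sep_subset _ _))
    ((hcont.mono (sep_subset _ _)).norm.pow 2) (C := C ^ 2) fun x hx => ?_
  rw [Real.norm_of_nonneg (by positivity)]
  exact pow_le_pow_left₀ (norm_nonneg _) (hC x hx.1) 2

theorem IsSolution.setIntegral_rpow_le (hop : IsOpen Ω) (hbdd : Bornology.IsBounded Ω)
    (hp : 1 < p) (hsol : IsSolution Ω p u) :
    ∫ x in {x ∈ Ω | 0 < u x}, u x ^ (p + 1) ≤ ∫ x in {x ∈ Ω | 0 < u x}, ‖gradient u x‖ ^ 2 := by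
  set G := {x ∈ Ω | 0 < u x}
  have hG : IsOpen G := hsol.isOpen_pos hop
  have hcu : ContinuousOn u G := hsol.1.continuousOn.mono (sep_subset _ _)
  have hgrad := hsol.integrableOn_gradient hop hbdd
  have hfi : IntegrableOn (fun x => u x ^ p) G := hsol.integrableOn_rpow hop hbdd (by linarith)
  have hfi' : IntegrableOn (fun x => u x ^ (p + 1)) G :=
    hsol.integrableOn_rpow hop hbdd (by linarith)
  have key (δ : ℝ) (hδ : 0 < δ) : (∫ x in G, u x ^ (p + 1)) - 2 * δ * ∫ x in G, u x ^ p ≤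
      ∫ x in G, ‖gradient u x‖ ^ 2 := by
    obtain ⟨φ, hφ, hφ0, hφn, hφ1, -, hφl⟩ := exists_smooth_positive_part hδ
    obtain ⟨Φ, hΦ, hΦ0, hΦd⟩ := exists_primitive_eq_zero (n := 1) (hφ.of_le (by norm_num)) hφ0
    have hΦ2 : ContDiff ℝ 2 Φ := by simpa [one_add_one_eq_two] using hΦ
    have hw := contDiff_indicator_comp hop hbdd hsol.1 hsol.2.1.continuousOn hsol.2.2.2 hδ hΦ2 hΦ0
    have hz := integral_mul_lap (contDiff_const (c := (1 : ℝ))) hw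
      (hasCompactSupport_indicator_comp hbdd hsol.2.1.continuousOn hΦ0)
    have hl1 (y : R2) : lap (fun _ : R2 => (1 : ℝ)) y = 0 := by simp [lap]
    simp only [hl1, one_mul, zero_mul, integral_zero, lap_indicator_comp hop hbdd hsol.1
      hsol.2.1.continuousOn hsol.2.2.2 hδ hΦ2 hΦ0] at hz
    rw [integral_indicator hG.measurableSet, hΦd] at hz
    have hgint1 : IntegrableOn (fun x => deriv φ (u x) * ‖gradient u x‖ ^ 2) G := by
      refine Integrable.mono hgrad ?_ (.of_forall fun x => ?_)
      · exact ((((hφ.continuous_deriv (by norm_num)).comp_continuousOn hcu).aestronglyMeasurable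
          hG.measurableSet)).mul hgrad.aestronglyMeasurable
      · rw [norm_mul, Real.norm_of_nonneg (hφn _)]
        exact mul_le_of_le_one_left (norm_nonneg _) (hφ1 _)
    obtain ⟨U, hU⟩ := hsol.exists_norm_le hbdd
    obtain ⟨C, hC⟩ := (isCompact_closedBall (0 : ℝ) U).exists_bound_of_continuousOn
      hφ.continuous.continuousOn
    have hgint2 : IntegrableOn (fun x => φ (u x) * lap u x) G := by
      have := (hsol.integrableOn_rpow_mul hop hbdd (q := p) (by linarith)
        (hφ.continuous.comp_continuousOn hcu) (C := C)
        fun x hx => hC _ (by simpa using hU x hx.1)).neg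
      refine this.congr_fun (fun x hx => ?_) hG.measurableSet
      simp only [Pi.neg_apply, hsol.lap_eq hx, Function.comp]
      ring
    have hgint3 : IntegrableOn (fun x => deriv φ (u x) * ‖gradient u x‖ ^ 2 +
      φ (u x) * lap u x) G := hgint1.add hgint2
    have hle : ∫ x in G, (u x ^ (p + 1) - 2 * δ * u x ^ p) ≤
        ∫ x in G, (‖gradient u x‖ ^ 2 -
          (deriv φ (u x) * ‖gradient u x‖ ^ 2 + φ (u x) * lap u x)) := by
      refine setIntegral_mono_on (hfi'.sub (hfi.const_mul _)) (hgrad.sub hgint3)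
        hG.measurableSet fun x hx => ?_
      have hx0 : 0 < u x := hx.2
      have hf : 0 < u x ^ p := rpow_pos_of_pos hx0 p
      rw [hsol.lap_eq hx, rpow_add_one hx0.ne']
      nlinarith [mul_le_mul_of_nonneg_left (hφl (u x)) hf.le,
        mul_le_mul_of_nonneg_right (hφ1 (u x)) (sq_nonneg ‖gradient u x‖)]
    rwa [integral_sub hfi' (hfi.const_mul _), integral_const_mul, integral_sub hgrad hgint3, hz,
      sub_zero] at hle
  by_contra! hlt
  set M := ∫ x in G, u x ^ p
  set E := ∫ x in G, u x ^ (p + 1)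
  set D := ∫ x in G, ‖gradient u x‖ ^ 2
  have hM : 0 ≤ M := setIntegral_nonneg hG.measurableSet fun x hx => rpow_nonneg hx.2.le p
  have := key ((E - D) / (4 * (M + 1))) (div_pos (by linarith) (by linarith))
  have h2 : 2 * ((E - D) / (4 * (M + 1))) * M ≤ (E - D) / 2 := by
    have h : 2 * ((E - D) / (4 * (M + 1))) * M = (E - D) / 2 * (M / (M + 1)) := by
      field_simp
      ring
    rw [h]
    exact mul_le_of_le_one_right (by linarith) ((div_le_one (by linarith)).2 (by linarith))
  linarith

end PositivePart

theorem continuous_lap {w : R2 → ℝ} (hw : ContDiff ℝ 2 w) : Continuous (lap w) :=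
  continuous_finsetSum _ fun _ _ =>
    ((((hw.fderiv_right (m := 1) (by norm_num)).clm_apply contDiff_const).continuous_fderiv
      (by norm_num)).clm_apply continuous_const)

theorem hasCompactSupport_lap {w : R2 → ℝ} (hw : HasCompactSupport w) :
    HasCompactSupport (lap w) := by
  refine hw.mono' fun x hx => ?_
  by_contra hn
  refine hx ?_
  rw [lap_congr (notMem_tsupport_iff_eventuallyEq.1 hn)]
  simp [lap]

section PositivePart

variable {Ω : Set R2} {p : ℝ} {u : R2 → ℝ}

theorem IsSolution.four_pi_mul_le (hop : IsOpen Ω) (hbdd : Bornology.IsBounded Ω)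
    (hp : 1 < p) (hsol : IsSolution Ω p u) {s R C : ℝ} (hs : 0 < s)
    (hR : ∀ x ∈ Ω, Ω ⊆ ball x R)
    (hC : ∀ (x : R2) (G : Set R2), MeasurableSet G → G ⊆ ball x R → ∀ a > 0,
      ∫ y in G, (‖x - y‖ ^ 2 + a) ^ (-s) ≤ C)
    {x : R2} (hx : x ∈ {x ∈ Ω | 0 < u x}) :
    4 * π * u x ≤ (∫ y in {x ∈ Ω | 0 < u x}, u y ^ p) * (Real.log (R ^ 2 + 1) + s⁻¹ *
      (p * Real.log ((∫ y in {x ∈ Ω | 0 < u x}, u y ^ (p + 1)) /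
        ∫ y in {x ∈ Ω | 0 < u x}, u y ^ p) -
        Real.log (∫ y in {x ∈ Ω | 0 < u x}, u y ^ p) + C - 1)) := by
  have hM := hsol.setIntegral_rpow_pos hop hbdd ⟨x, hx⟩ (q := p) (by linarith)
  have hE := hsol.setIntegral_rpow_pos hop hbdd ⟨x, hx⟩ (q := p + 1) (by linarith)
  have hG : IsOpen {x ∈ Ω | 0 < u x} := hsol.isOpen_pos hop
  set G := {x ∈ Ω | 0 < u x}
  set M := ∫ y in G, u y ^ p
  set E := ∫ y in G, u y ^ (p + 1)
  set B := M * (Real.log (R ^ 2 + 1) + s⁻¹ * (p * Real.log (E / M) - Real.log M + C - 1))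
  have hGb : Bornology.IsBounded G := hbdd.subset (sep_subset _ _)
  have hfi : IntegrableOn (fun y => u y ^ p) G := hsol.integrableOn_rpow hop hbdd (by linarith)
  have hbound {g : R2 → ℝ} (hg : Continuous g) : ∃ K, ∀ y ∈ G, ‖g y‖ ≤ K := by
    obtain ⟨K, hK⟩ := hGb.isCompact_closure.exists_bound_of_continuousOn hg.continuousOn
    exact ⟨K, fun y hy => hK y (subset_closure hy)⟩
  have hpot (a : ℝ) (ha : 0 < a) :
      ∫ y in G, u y ^ p * (Real.log (R ^ 2 + 1) - Real.log (‖x - y‖ ^ 2 + a)) ≤ B := by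
    have hpos (y : R2) : 0 < ‖x - y‖ ^ 2 + a := by positivity
    have hcont : Continuous fun y : R2 => ‖x - y‖ ^ 2 + a := by fun_prop
    have hch : Continuous fun y : R2 => (‖x - y‖ ^ 2 + a) ^ (-s) :=
      hcont.rpow_const fun y => .inl (hpos y).ne'
    have hcl : Continuous fun y : R2 => Real.log ((‖x - y‖ ^ 2 + a) ^ (-s)) :=
      hch.log fun y => (rpow_pos_of_pos (hpos y) _).ne'
    obtain ⟨K, hK⟩ := hbound hch
    obtain ⟨K', hK'⟩ := hbound hcl
    have hgint := hsol.integrableOn_rpow_mul hop hbdd (q := p) (by linarith) hcl.continuousOn hK'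
    have hent := setIntegral_rpow_mul_log_le hG.measurableSet (p := p) (by linarith)
      (fun y hy => hy.2) (fun y _ => rpow_pos_of_pos (hpos y) (-s)) hM hE
      (integrableOn_of_norm_le hG hGb hch.continuousOn hK) hgint
    have hrew : ∫ y in G, u y ^ p * (Real.log (R ^ 2 + 1) - Real.log (‖x - y‖ ^ 2 + a)) =
        M * Real.log (R ^ 2 + 1) + s⁻¹ *
          ∫ y in G, u y ^ p * Real.log ((‖x - y‖ ^ 2 + a) ^ (-s)) := by
      rw [← integral_mul_const, ← integral_const_mul,
        ← integral_add (hfi.mul_const _) (hgint.const_mul _)]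
      congr 1 with y
      rw [Real.log_rpow (hpos y)]
      field_simp
      ring
    rw [hrew]
    have hCa := hC x G hG.measurableSet ((sep_subset _ _).trans (hR x hx.1)) a ha
    have h1 : M * (p * Real.log (E / M) - Real.log M + (∫ y in G, (‖x - y‖ ^ 2 + a) ^ (-s)) - 1) ≤
        M * (p * Real.log (E / M) - Real.log M + C - 1) :=
      mul_le_mul_of_nonneg_left (by linarith) hM.le
    have h2 := mul_le_mul_of_nonneg_left (hent.trans h1) (inv_nonneg.2 hs.le)
    calc _ ≤ M * Real.log (R ^ 2 + 1) +
          s⁻¹ * (M * (p * Real.log (E / M) - Real.log M + C - 1)) := by linarith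
      _ = B := by ring
  have key (δ : ℝ) (hδ : 0 < δ) : 4 * π * (u x - 2 * δ) ≤ B := by
    obtain ⟨φ, hφ, hφ0, hφn, hφ1, hφ2, hφl⟩ := exists_smooth_positive_part hδ
    have hw := contDiff_indicator_comp hop hbdd hsol.1 hsol.2.1.continuousOn hsol.2.2.2 hδ hφ hφ0
    have hwc := hasCompactSupport_indicator_comp hbdd hsol.2.1.continuousOn hφ0
    have hlap := lap_indicator_comp hop hbdd hsol.1 hsol.2.1.continuousOn hsol.2.2.2 hδ hφ hφ0
    set w := Ω.indicator fun y => φ (u y) with hwdef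
    have hwx : u x - 2 * δ ≤ w x := by
      rw [hwdef, indicator_of_mem hx.1]
      exact hφl _
    refine (mul_le_mul_of_nonneg_left hwx (by positivity)).trans
      (le_of_tendsto (tendsto_integral_log_mul_lap hw hwc x) ?_)
    filter_upwards [eventually_ge_atTop 1] with c hc
    set a := (c ^ 2)⁻¹
    have ha : 0 < a := by positivity
    have ha1 : a ≤ 1 := inv_le_one_of_one_le₀ (one_le_pow₀ hc)
    have hpos (y : R2) : 0 < ‖x - y‖ ^ 2 + a := by positivity
    have hlogc : Continuous fun y : R2 => Real.log (‖x - y‖ ^ 2 + a) :=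
      (contDiff_log_norm_sq_add x ha (n := 0)).continuous
    have hzero : ∫ y, Real.log (R ^ 2 + 1) * lap w y = 0 := by
      rw [integral_mul_lap contDiff_const hw hwc]
      simp [lap]
    have hgint1 : Integrable fun y => Real.log (‖x - y‖ ^ 2 + a) * lap w y :=
      (hlogc.mul (continuous_lap hw)).integrable_of_hasCompactSupport
        (hasCompactSupport_lap hwc).mul_left
    have hgint2 : Integrable fun y => Real.log (R ^ 2 + 1) * lap w y :=
      (continuous_const.mul (continuous_lap hw)).integrable_of_hasCompactSupport
        (hasCompactSupport_lap hwc).mul_left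
    obtain ⟨K, hK⟩ := hbound (continuous_const.sub hlogc : Continuous fun y : R2 =>
      Real.log (R ^ 2 + 1) - Real.log (‖x - y‖ ^ 2 + a))
    have hgint3 := hsol.integrableOn_rpow_mul hop hbdd (q := p) (by linarith)
      (continuous_const.sub hlogc).continuousOn hK
    refine le_trans ?_ (hpot a ha)
    rw [← integral_indicator hG.measurableSet, ← sub_zero (∫ y, Real.log (‖x - y‖ ^ 2 + a) * _),
      ← hzero, ← integral_sub hgint1 hgint2]
    refine integral_mono (hgint1.sub hgint2)
      ((integrable_indicator_iff hG.measurableSet).2 hgint3) fun y => ?_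
    simp only [hlap y]
    by_cases hy : y ∈ G
    · rw [indicator_of_mem hy, indicator_of_mem hy, hsol.lap_eq hy]
      have hf : 0 ≤ u y ^ p := rpow_nonneg hy.2.le p
      have hlog : Real.log (‖x - y‖ ^ 2 + a) ≤ Real.log (R ^ 2 + 1) := by
        refine Real.log_le_log (hpos y) (add_le_add (pow_le_pow_left₀ (norm_nonneg _) ?_ 2) ha1)
        have := hR x hx.1 hy.1
        rw [mem_ball, dist_eq_norm, norm_sub_rev] at this
        exact this.le
      have h1 : -(u y ^ p) ≤
          deriv (deriv φ) (u y) * ‖gradient u y‖ ^ 2 + deriv φ (u y) * -u y ^ p := by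
        nlinarith [mul_nonneg (hφ2 (u y)) (sq_nonneg ‖gradient u y‖),
          mul_le_mul_of_nonneg_right (hφ1 (u y)) hf]
      nlinarith [mul_le_mul_of_nonneg_left h1 (sub_nonneg.2 hlog)]
    · rw [indicator_of_notMem hy, indicator_of_notMem hy]
      simp
  by_contra! hlt
  have hpi := pi_pos
  have := key ((4 * π * u x - B) / (16 * π)) (div_pos (by linarith) (by positivity))
  have h2 : 4 * π * (2 * ((4 * π * u x - B) / (16 * π))) = (4 * π * u x - B) / 2 := by
    field_simp
    ring
  linarith

end PositivePart

/-- The two inequalities relating the energy `E = ∫ (u⁺) ^ (p + 1)` of the positive part of a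
solution to the ratio `m = ∫ (u⁺) ^ (p + 1) / ∫ (u⁺) ^ p`. -/
theorem exists_energy_inequalities {Ω : Set R2} (hop : IsOpen Ω) (hbdd : Bornology.IsBounded Ω)
    {s : ℝ} (hs0 : 0 < s) (hs : s < 1) :
    ∃ C K : ℝ, ∀ p > 1, ∀ u, IsSolution Ω p u → (∃ x ∈ Ω, 0 < u x) → ∃ E m : ℝ, 0 < E ∧ 0 < m ∧
      E ≤ ∫ x in {x ∈ Ω | 0 < u x}, ‖gradient u x‖ ^ 2 ∧
      4 * π * s * m ^ 2 ≤ E * (C + (p + 1) * Real.log m - Real.log E) ∧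
      Real.log E - K ≤ (p + 1) * Real.log m := by
  obtain ⟨r, hr⟩ := hbdd.subset_ball 0
  have hR : ∀ x ∈ Ω, Ω ⊆ ball x (2 * r) := by
    intro x hx y hy
    have h1 := hr hx
    have h2 := hr hy
    rw [mem_ball] at h1 h2 ⊢
    linarith [dist_triangle_right y x 0]
  obtain ⟨C, hC⟩ := exists_setIntegral_rpow_le (R := 2 * r) hs0 hs
  refine ⟨s * Real.log ((2 * r) ^ 2 + 1) + C, volume.real Ω, fun p hp u hsol hpos => ?_⟩
  have hM := hsol.setIntegral_rpow_pos hop hbdd hpos (q := p) (by linarith)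
  have hE := hsol.setIntegral_rpow_pos hop hbdd hpos (q := p + 1) (by linarith)
  have hgrad := hsol.setIntegral_rpow_le hop hbdd hp
  have hG : IsOpen {x ∈ Ω | 0 < u x} := hsol.isOpen_pos hop
  have hsup (x) (hx : x ∈ {x ∈ Ω | 0 < u x}) := hsol.four_pi_mul_le hop hbdd hp hs0 hR hC hx
  have hfi := hsol.integrableOn_rpow hop hbdd (q := p) (by linarith)
  have hfi' := hsol.integrableOn_rpow hop hbdd (q := p + 1) (by linarith)
  have hGb : Bornology.IsBounded {x ∈ Ω | 0 < u x} := hbdd.subset (sep_subset _ _)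
  have hent := setIntegral_rpow_mul_log_le hG.measurableSet (h := fun _ => 1) (p := p)
    (by linarith) (fun y hy => hy.2) (fun _ _ => one_pos) hM hE
    (integrableOn_of_norm_le hG hGb continuousOn_const (C := 1) (by simp)) (by simp)
  have hvol : volume.real {x ∈ Ω | 0 < u x} ≤ volume.real Ω :=
    measureReal_mono (sep_subset _ _) hbdd.measure_lt_top.ne
  set G := {x ∈ Ω | 0 < u x}
  set M := ∫ y in G, u y ^ p
  set E := ∫ y in G, u y ^ (p + 1)
  set L := Real.log (E / M)
  have hL : L = Real.log E - Real.log M := Real.log_div hE.ne' hM.ne'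
  have hlogM : Real.log M = Real.log E - L := by linarith
  refine ⟨E, E / M, hE, div_pos hE hM, hgrad, ?_, ?_⟩
  · set B := Real.log ((2 * r) ^ 2 + 1) + s⁻¹ * (p * L - Real.log M + C - 1) with hB
    have h1 : ∫ y in G, 4 * π * u y ^ (p + 1) ≤ ∫ y in G, M * B * u y ^ p := by
      refine setIntegral_mono_on (hfi'.const_mul _) (hfi.const_mul _) hG.measurableSet
        fun y hy => ?_
      rw [rpow_add_one hy.2.ne']
      nlinarith [mul_le_mul_of_nonneg_right (hsup y hy) (rpow_nonneg hy.2.le p)]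
    rw [integral_const_mul, integral_const_mul] at h1
    have h2 : 4 * π * E ≤ M * B * M := h1
    have h3 : 4 * π * s * (E / M) ^ 2 ≤ E * (s * B) := by
      have : 4 * π * s * (E / M) ^ 2 = (4 * π * E) * (s * E / M ^ 2) := by
        field_simp
      rw [this]
      refine (mul_le_mul_of_nonneg_right h2 (by positivity)).trans_eq ?_
      field_simp
    refine h3.trans (mul_le_mul_of_nonneg_left ?_ hE.le)
    rw [hB, mul_add, mul_inv_cancel_left₀ hs0.ne', hlogM]
    linarith
  · simp only [Real.log_one, mul_zero, integral_zero, integral_const, smul_eq_mul, mul_one,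
      measureReal_restrict_apply_univ] at hent
    have := nonneg_of_mul_nonneg_right hent hM
    rw [hlogM] at this
    linarith

theorem exists_exp_half_mul_lt (C : ℝ) {δ : ℝ} (hδ : 0 < δ) :
    ∃ l₀ < 0, ∀ l ≤ l₀, Real.exp (l / 2) * (C - l) < δ := by
  have h1 : Tendsto (fun x : ℝ => C * Real.exp (-x) + 2 * (x ^ 1 * Real.exp (-x))) atTop
      (𝓝 (C * 0 + 2 * 0)) :=
    (tendsto_exp_neg_atTop_nhds_zero.const_mul C).add
      ((tendsto_pow_mul_exp_neg_atTop_nhds_zero 1).const_mul 2)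
  rw [mul_zero, mul_zero, add_zero] at h1
  obtain ⟨x₀, hx₀⟩ := eventually_atTop.1 (h1.eventually_lt_const hδ)
  refine ⟨min (-1) (-2 * x₀), (min_le_left _ _).trans_lt (by norm_num), fun l hl => ?_⟩
  have h := hx₀ (-l / 2) (by linarith [hl.trans (min_le_right _ _)])
  rw [show -(-l / 2) = l / 2 by ring] at h
  linarith

theorem exists_forall_le_mul {s σ : ℝ} (hσ : 0 < σ) (hσs : σ < s) (C K : ℝ) :
    ∃ p₀ : ℝ, ∀ p ≥ p₀, ∀ E > 0, ∀ m > 0,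
      4 * π * s * m ^ 2 ≤ E * (C + (p + 1) * Real.log m - Real.log E) →
      Real.log E - K ≤ (p + 1) * Real.log m → 8 * π * Real.exp 1 * σ ≤ (p + 1) * E := by
  have hπ := Real.pi_pos
  have hs : 0 < s := hσ.trans hσs
  obtain ⟨l₀, hl₀, hl⟩ := exists_exp_half_mul_lt C
    (δ := min (4 * π * (s - σ)) (4 * π * s * Real.exp (-|K| / 2)))
    (lt_min (mul_pos (by positivity) (sub_pos.2 hσs)) (by positivity))
  refine ⟨max 3 (8 * π * Real.exp 1 * σ / Real.exp l₀), fun p hp E hE m hm h1 h2 => ?_⟩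
  by_contra! hX
  have hp3 : 3 ≤ p := (le_max_left _ _).trans hp
  have hEl : E < Real.exp l₀ := by
    have h := (div_le_iff₀ (Real.exp_pos l₀)).1 ((le_max_right _ _).trans hp)
    by_contra! hn
    nlinarith [mul_le_mul_of_nonneg_left hn (by linarith : 0 ≤ p)]
  have hlogE : Real.log E < l₀ := by rwa [Real.log_lt_iff_lt_exp hE]
  have hsmall := hl _ hlogE.le
  have hroot : Real.exp (Real.log E / 2) * Real.exp (Real.log E / 2) = E := by
    rw [← Real.exp_add, add_halves, Real.exp_log hE]
  have hm2 : Real.exp (2 * Real.log m) = m ^ 2 := by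
    rw [two_mul, Real.exp_add, Real.exp_log hm, sq]
  set l := Real.log E
  set L := Real.log m
  set r := Real.exp (l / 2)
  have hr : 0 < r := Real.exp_pos _
  have hr1 : r < 1 := Real.exp_lt_one_iff.2 (by linarith)
  rw [← hm2] at h1
  rcases le_or_gt 0 L with hL | hL
  · have hlt : r * (C - l) < 4 * π * (s - σ) := hsmall.trans_le (min_le_left _ _)
    have ht : E * (C - l) < 4 * π * (s - σ) := by
      have : 0 < 4 * π * (s - σ) := mul_pos (by positivity) (sub_pos.2 hσs)
      rw [← hroot, mul_assoc]
      rcases le_or_gt 0 (r * (C - l)) with h | h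
      · exact (mul_le_of_le_one_left h hr1.le).trans_lt hlt
      · exact (mul_neg_of_pos_of_neg hr h).trans this
    have hexp : Real.exp 1 * (2 * L) ≤ Real.exp (2 * L) := by
      rw [show Real.exp (2 * L) = Real.exp 1 * Real.exp (2 * L - 1) by
        rw [← Real.exp_add, add_sub_cancel]]
      gcongr
      linarith [Real.add_one_le_exp (2 * L - 1)]
    have hXL : (p + 1) * E * L ≤ 8 * π * Real.exp 1 * σ * L :=
      mul_le_mul_of_nonneg_right hX.le hL
    have hσL := mul_le_mul_of_nonneg_left hexp (by positivity : 0 ≤ 4 * π * σ)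
    have hone : 4 * π * (s - σ) * 1 ≤ 4 * π * (s - σ) * Real.exp (2 * L) :=
      mul_le_mul_of_nonneg_left (Real.one_le_exp (by linarith))
        (mul_pos (by positivity) (sub_pos.2 hσs)).le
    linarith
  · have hneg : E * ((p + 1) * L) ≤ 0 :=
      mul_nonpos_of_nonneg_of_nonpos hE.le
        (mul_nonpos_of_nonneg_of_nonpos (by linarith) hL.le)
    have hlow : r * Real.exp (-|K| / 2) ≤ Real.exp (2 * L) := by
      rw [← Real.exp_add]
      refine Real.exp_le_exp.2 ?_
      have hK := le_abs_self K
      have hK0 := abs_nonneg K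
      by_contra! hn
      nlinarith [mul_lt_mul_of_pos_left hn (by linarith : 0 < p + 1)]
    have hlt : r * (C - l) < 4 * π * s * Real.exp (-|K| / 2) :=
      hsmall.trans_le (min_le_right _ _)
    have h3 := mul_lt_mul_of_pos_left hlt hr
    have h4 := mul_le_mul_of_nonneg_left hlow (by positivity : 0 ≤ 4 * π * s)
    rw [← mul_assoc, hroot] at h3
    linarith

theorem IsSolution.neg {Ω : Set R2} {p : ℝ} {u : R2 → ℝ} (h : IsSolution Ω p u) :
    IsSolution Ω p fun x => -u x := by
  refine ⟨h.1.neg, h.2.1.neg, fun x hx => ?_, fun x hx => ?_⟩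
  · have hlap : lap (fun x => -u x) x = -lap u x := by simp [lap, fderiv_fun_neg]
    rw [hlap, h.2.2.1 x hx, abs_neg, mul_neg, ← h.2.2.1 x hx]
  · simp [h.2.2.2 x hx]

theorem norm_gradient_neg (u : R2 → ℝ) (x : R2) :
    ‖gradient (fun y => -u y) x‖ = ‖gradient u x‖ := by
  simp [gradient, fderiv_fun_neg]

/-- The asymptotic lower bound for the energy of one nodal region, uniform over all solutions. -/
theorem exists_energy_lower_bound {Ω : Set R2} (hop : IsOpen Ω) (hbdd : Bornology.IsBounded Ω)
    {ε : ℝ} (hε : 0 < ε) :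
    ∃ p₀ > 1, ∀ p ≥ p₀, ∀ u, IsSolution Ω p u → (∃ x ∈ Ω, 0 < u x) →
      4 * π * Real.exp 1 - ε
        ≤ p * (1 / 2 - 1 / (p + 1)) * ∫ x in {x ∈ Ω | 0 < u x}, ‖gradient u x‖ ^ 2 := by
  have hπ := Real.pi_pos
  set A := 4 * π * Real.exp 1 with hA
  have hA0 : 0 < A := by positivity
  obtain ⟨σ, hσ0, hσ1, hσ⟩ : ∃ σ : ℝ, 0 < σ ∧ σ < 1 ∧ A - ε < A * σ := by
    refine ⟨max (1 / 2) (1 - ε / (2 * A)), by positivity, max_lt (by norm_num) ?_, ?_⟩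
    · linarith [show 0 < ε / (2 * A) by positivity]
    · refine lt_of_lt_of_le ?_ (mul_le_mul_of_nonneg_left (le_max_right _ _) hA0.le)
      rw [mul_sub, show A * (ε / (2 * A)) = ε / 2 by field_simp]
      linarith
  obtain ⟨s, hσs, hs1⟩ := exists_between hσ1
  obtain ⟨C, K, hCK⟩ := exists_energy_inequalities hop hbdd (hσ0.trans hσs) hs1
  obtain ⟨p₁, hp₁⟩ := exists_forall_le_mul hσ0 hσs C K
  have hlim : Tendsto (fun p : ℝ => A * σ * ((1 - (p + 1)⁻¹) * (1 - 2 * (p + 1)⁻¹))) atTop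
      (𝓝 (A * σ * ((1 - 0) * (1 - 2 * 0)))) := by
    have h : Tendsto (fun p : ℝ => (p + 1)⁻¹) atTop (𝓝 0) :=
      tendsto_inv_atTop_zero.comp (tendsto_atTop_add_const_right _ 1 tendsto_id)
    exact ((h.const_sub 1).mul ((h.const_mul 2).const_sub 1)).const_mul _
  obtain ⟨p₂, hp₂⟩ := eventually_atTop.1 (hlim.eventually_const_le (u := A - ε) (by linarith))
  refine ⟨max 2 (max p₁ p₂), lt_max_of_lt_left one_lt_two, fun p hp u hsol hpos => ?_⟩
  have hp2 : 2 ≤ p := (le_max_left _ _).trans hp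
  obtain ⟨E, m, hE, hm, hle, h1, h2⟩ := hCK p (by linarith) u hsol hpos
  have h3 := hp₁ p ((le_max_left _ _).trans ((le_max_right _ _).trans hp)) E hE m hm h1 h2
  have h4 := hp₂ p ((le_max_right _ _).trans ((le_max_right _ _).trans hp))
  have hp0 : 0 < p + 1 := by linarith
  have hinv : (p + 1)⁻¹ ≤ 3⁻¹ := inv_anti₀ (by norm_num) (by linarith)
  have hfac : 0 ≤ (1 - (p + 1)⁻¹) * (1 - 2 * (p + 1)⁻¹) / 2 :=
    div_nonneg (mul_nonneg (by linarith) (by linarith)) two_pos.le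
  have hcoef : p * (1 / 2 - 1 / (p + 1)) =
      (1 - (p + 1)⁻¹) * (1 - 2 * (p + 1)⁻¹) / 2 * (p + 1) := by
    field_simp
    ring
  calc A - ε ≤ A * σ * ((1 - (p + 1)⁻¹) * (1 - 2 * (p + 1)⁻¹)) := h4
    _ = (1 - (p + 1)⁻¹) * (1 - 2 * (p + 1)⁻¹) / 2 * (8 * π * Real.exp 1 * σ) := by
      rw [hA]; ring
    _ ≤ (1 - (p + 1)⁻¹) * (1 - 2 * (p + 1)⁻¹) / 2 * ((p + 1) * E) := by gcongr
    _ = p * (1 / 2 - 1 / (p + 1)) * E := by rw [hcoef, mul_assoc]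
    _ ≤ _ := by
      refine mul_le_mul_of_nonneg_left hle ?_
      rw [hcoef]
      positivity

theorem stmt2
    (Ω : Set R2) (hne : Ω.Nonempty) (hop : IsOpen Ω)
    (hbdd : Bornology.IsBounded Ω) (hconn : IsConnected Ω) (hsm : SmoothBoundary Ω)
    (u : ℝ → R2 → ℝ)
    (hsol : ∀ p > (1:ℝ), IsSolution Ω p (u p))
    (hnod : ∀ p > (1:ℝ), IsNodal Ω (u p)) :
    ∀ ε > (0:ℝ), ∃ pε : ℝ, ∀ p ≥ pε,
      4 * π * Real.exp 1 - ε
          ≤ p * (1 / 2 - 1 / (p + 1)) * ∫ x in {x ∈ Ω | 0 < u p x}, ‖gradient (u p) x‖ ^ 2 ∧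
      4 * π * Real.exp 1 - ε
          ≤ p * (1 / 2 - 1 / (p + 1)) * ∫ x in {x ∈ Ω | u p x < 0}, ‖gradient (u p) x‖ ^ 2 := by
  intro ε hε
  obtain ⟨p₀, hp₀, h⟩ := exists_energy_lower_bound hop hbdd hε
  refine ⟨p₀, fun p hp => ?_⟩
  have hp1 : 1 < p := hp₀.trans_le hp
  refine ⟨h p hp _ (hsol p hp1) (hnod p hp1).1, ?_⟩
  have hneg := h p hp _ (hsol p hp1).neg (by simpa using (hnod p hp1).2)
  simpa only [norm_gradient_neg, neg_pos] using hneg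
end
end

section
/- Let (u_p)_{p>1} be a family of nodal solutions of (𝒫_p) satisfying condition (A). Then for all p sufficiently large the open set {x ∈ Ω : u_p(x) ≠ 0} has exactly two connected components (u_p has exactly two nodal domains). -/
open MeasureTheory Real Set Filter Topology Metric

noncomputable section

open scoped ENNReal

/-- Integration in polar coordinates on the plane. -/
lemma lintegral_polar_R2 (f : R2 → ℝ≥0∞) (hf : Measurable f) :
    ∫⁻ z, f z = ∫⁻ ω, (∫⁻ r in Ioi (0 : ℝ), ENNReal.ofReal r * f (r • (ω : R2)))
      ∂((volume : Measure R2).toSphere) := by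
  have h := (volume : Measure R2).measurePreserving_homeomorphUnitSphereProd
  have hd : Module.finrank ℝ R2 = 2 := by simp [R2]
  rw [hd] at h
  have h1 := h.symm (homeomorphUnitSphereProd R2).toMeasurableEquiv
  have h2 : ∫⁻ z, f z = ∫⁻ z : ({(0 : R2)}ᶜ : Set R2), f z
      ∂((volume : Measure R2).comap Subtype.val) := by
    conv_lhs => rw [← MeasureTheory.restrict_compl_singleton (μ := (volume : Measure R2)) 0]
    exact (lintegral_subtype_comap (measurableSet_singleton _).compl f).symm
  rw [h2, ← h1.lintegral_comp_emb (MeasurableEquiv.measurableEmbedding _)]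
  rw [lintegral_prod]
  · refine lintegral_congr fun ω => ?_
    rw [Measure.volumeIoiPow, lintegral_withDensity_eq_lintegral_mul]
    · simp only [Pi.mul_apply]
      rw [← lintegral_subtype_comap measurableSet_Ioi]
      refine lintegral_congr fun r => ?_
      simp [homeomorphUnitSphereProd]
    · fun_prop
    · refine hf.comp (measurable_subtype_coe.comp ?_)
      exact (MeasurableEquiv.measurable _).comp (by fun_prop)
  · refine (hf.comp (measurable_subtype_coe.comp ?_)).aemeasurable
    exact (MeasurableEquiv.measurable _)

lemma toSphere_R2_univ :
    (volume : Measure R2).toSphere univ = ENNReal.ofReal (2 * π) := by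
  rw [Measure.toSphere_apply_univ, EuclideanSpace.volume_ball_fin_two]
  simp [R2, ENNReal.ofReal_mul]

lemma lintegral_radial_R2 (g : ℝ → ℝ≥0∞) (hg : Measurable g) :
    ∫⁻ z : R2, g ‖z‖ = ENNReal.ofReal (2 * π) * ∫⁻ r in Ioi (0 : ℝ), ENNReal.ofReal r * g r := by
  rw [lintegral_polar_R2 (fun z => g ‖z‖) (hg.comp measurable_norm)]
  have : ∀ ω : sphere (0 : R2) 1,
      ∫⁻ r in Ioi (0 : ℝ), ENNReal.ofReal r * g ‖r • (ω : R2)‖ =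
        ∫⁻ r in Ioi (0 : ℝ), ENNReal.ofReal r * g r := by
    intro ω
    refine setLIntegral_congr_fun measurableSet_Ioi fun r hr => ?_
    simp [norm_smul, abs_of_pos (mem_Ioi.1 hr)]
  simp_rw [this]
  rw [lintegral_const, toSphere_R2_univ, mul_comm]

lemma ofReal_mul_inv_enorm_self {r : ℝ} (hr : 0 < r) :
    ENNReal.ofReal r * ‖r‖ₑ⁻¹ = 1 := by
  rw [Real.enorm_of_nonneg hr.le]
  exact ENNReal.mul_inv_cancel (by simpa using hr) ENNReal.ofReal_ne_top

lemma lintegral_ball_inv_enorm (δ : ℝ) :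
    ∫⁻ z in ball (0 : R2) δ, ‖z‖ₑ⁻¹ = ENNReal.ofReal (2 * π * δ) := by
  have h := lintegral_radial_R2 ((Iio δ).indicator fun r : ℝ => ‖r‖ₑ⁻¹)
    ((by fun_prop : Measurable fun r : ℝ => ‖r‖ₑ⁻¹).indicator measurableSet_Iio)
  rw [← lintegral_indicator measurableSet_ball]
  have e1 : ∀ z : R2, (ball (0 : R2) δ).indicator (fun z : R2 => ‖z‖ₑ⁻¹) z =
      (Iio δ).indicator (fun r : ℝ => ‖r‖ₑ⁻¹) ‖z‖ := by
    intro z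
    by_cases hz : ‖z‖ < δ <;> simp [Set.indicator, hz]
  simp_rw [e1]
  rw [h, ENNReal.ofReal_mul (p := 2 * π) (by positivity)]
  congr 1
  have e2 : ∫⁻ r in Ioi (0 : ℝ), ENNReal.ofReal r * (Iio δ).indicator (fun r : ℝ => ‖r‖ₑ⁻¹) r =
      ∫⁻ r in Ioi (0 : ℝ), (Iio δ).indicator 1 r := by
    refine setLIntegral_congr_fun measurableSet_Ioi fun r hr => ?_
    by_cases hrd : r < δ
    · simp only [indicator, mem_Iio, hrd, if_true]
      exact ofReal_mul_inv_enorm_self hr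
    · simp [indicator, hrd]
  rw [e2, lintegral_indicator_one measurableSet_Iio, Measure.restrict_apply measurableSet_Iio,
    inter_comm, Ioi_inter_Iio, Real.volume_Ioo, sub_zero]

lemma lintegral_annulus_inv_enorm_sq (δ R : ℝ) (hδ : 0 < δ) (hR : δ ≤ R) :
    ∫⁻ z in ball (0 : R2) R \ ball 0 δ, (‖z‖ₑ⁻¹) ^ 2 =
      ENNReal.ofReal (2 * π * Real.log (R / δ)) := by
  have h := lintegral_radial_R2 ((Ico δ R).indicator fun r : ℝ => (‖r‖ₑ⁻¹) ^ 2)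
    ((by fun_prop : Measurable fun r : ℝ => (‖r‖ₑ⁻¹) ^ 2).indicator measurableSet_Ico)
  rw [← lintegral_indicator (measurableSet_ball.diff measurableSet_ball)]
  have e1 : ∀ z : R2, (ball (0 : R2) R \ ball 0 δ).indicator (fun z : R2 => (‖z‖ₑ⁻¹) ^ 2) z =
      (Ico δ R).indicator (fun r : ℝ => (‖r‖ₑ⁻¹) ^ 2) ‖z‖ := by
    intro z
    by_cases hz : ‖z‖ < δ <;> by_cases hz' : ‖z‖ < R <;>
      simp [Set.indicator, hz, hz', not_le.2, not_lt.1]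
  simp_rw [e1]
  rw [h, ENNReal.ofReal_mul (p := 2 * π) (by positivity)]
  congr 1
  have e2 : ∫⁻ r in Ioi (0 : ℝ), ENNReal.ofReal r *
      (Ico δ R).indicator (fun r : ℝ => (‖r‖ₑ⁻¹) ^ 2) r =
      ∫⁻ r in Ioi (0 : ℝ), (Ico δ R).indicator (fun r => ENNReal.ofReal (r⁻¹)) r := by
    refine setLIntegral_congr_fun measurableSet_Ioi fun r hr => ?_
    by_cases hrd : r ∈ Ico δ R
    · simp only [indicator, hrd, if_true]
      rw [pow_two, ← mul_assoc, ofReal_mul_inv_enorm_self hr, one_mul,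
        Real.enorm_of_nonneg (le_of_lt hr), ENNReal.ofReal_inv_of_pos hr]
    · simp [indicator, hrd]
  rw [e2, lintegral_indicator measurableSet_Ico, Measure.restrict_restrict measurableSet_Ico,
    inter_eq_left.2 (show Ico δ R ⊆ Ioi 0 from fun x hx => hδ.trans_le hx.1),
    setLIntegral_congr Ico_ae_eq_Ioc]
  have hint : IntervalIntegrable (fun r : ℝ => r⁻¹) volume δ R :=
    intervalIntegral.intervalIntegrable_inv (fun x hx => by
      rw [uIcc_of_le hR] at hx; exact (hδ.trans_le hx.1).ne') continuousOn_id
  rw [← ofReal_integral_eq_lintegral_ofReal hint.1, ← intervalIntegral.integral_of_le hR,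
    integral_inv_of_pos hδ (hδ.trans_le hR)]
  filter_upwards [ae_restrict_mem measurableSet_Ioc] with x hx
  exact inv_nonneg.2 (hδ.le.trans hx.1.le)

lemma enorm_le_lintegral_ray {v : R2 → ℝ} (hv : ContDiff ℝ 1 v) (hc : HasCompactSupport v)
    (x ω : R2) (hω : ‖ω‖ = 1) :
    ‖v x‖ₑ ≤ ∫⁻ r in Ioi (0 : ℝ), ‖fderiv ℝ v (x + r • ω)‖ₑ := by
  let f : ℝ → ℝ := fun r => v (x + r • ω)
  have hf : ContDiff ℝ 1 f := hv.comp (by fun_prop)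
  have hemb : IsClosedEmbedding fun r : ℝ => x + r • ω := by
    refine Isometry.isClosedEmbedding (Isometry.of_dist_eq fun a b => ?_)
    rw [dist_add_left, dist_eq_norm, ← sub_smul, norm_smul, hω, mul_one, dist_eq_norm]
  have hfc : HasCompactSupport f := hc.comp_isClosedEmbedding hemb
  have h1 := hfc.integral_Ioi_deriv_eq hf 0
  have h2 : ‖v x‖ₑ = ‖∫ r in Ioi (0 : ℝ), deriv f r‖ₑ := by
    rw [h1]; simp [f]
  rw [h2]
  refine (enorm_integral_le_lintegral_enorm _).trans (lintegral_mono fun r => ?_)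
  have hd : HasDerivAt f (fderiv ℝ v (x + r • ω) ω) r := by
    have a := (hv.differentiable (by simp) (x + r • ω)).hasFDerivAt
    have b : HasDerivAt (fun r : ℝ => x + r • ω) ω r := by
      simpa using ((hasDerivAt_id r).smul_const ω).const_add x
    exact a.comp_hasDerivAt r b
  rw [hd.deriv]
  have := (fderiv ℝ v (x + r • ω)).le_opNorm ω
  rw [hω, mul_one] at this
  exact enorm_le_iff_norm_le.2 this

lemma enorm_le_lintegral_fderiv {v : R2 → ℝ} (hv : ContDiff ℝ 1 v) (hc : HasCompactSupport v)
    (x : R2) :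
    ENNReal.ofReal (2 * π) * ‖v x‖ₑ ≤ ∫⁻ z, ‖fderiv ℝ v (x + z)‖ₑ * ‖z‖ₑ⁻¹ := by
  have hcont : Continuous (fderiv ℝ v) := hv.continuous_fderiv (by simp)
  rw [lintegral_polar_R2 _ (by fun_prop), mul_comm, ← toSphere_R2_univ, ← lintegral_const]
  refine lintegral_mono fun ω => ?_
  have hω : ‖(ω : R2)‖ = 1 := by simp
  refine (enorm_le_lintegral_ray hv hc x ω hω).trans (le_of_eq ?_)
  refine setLIntegral_congr_fun measurableSet_Ioi fun r hr => ?_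
  have : ‖r • (ω : R2)‖ₑ = ‖r‖ₑ := by
    rw [enorm_smul, ← ofReal_norm (ω : R2), hω]; simp
  simp only [this]
  rw [mul_left_comm, ofReal_mul_inv_enorm_self hr, mul_one]

lemma sq_lintegral_mul_le {α : Type*} [MeasurableSpace α] (μ : Measure α) {f g : α → ℝ≥0∞}
    (hf : AEMeasurable f μ) (hg : AEMeasurable g μ) :
    (∫⁻ a, f a * g a ∂μ) ^ 2 ≤ (∫⁻ a, f a ^ 2 ∂μ) * ∫⁻ a, g a ^ 2 ∂μ := by
  have h := ENNReal.lintegral_mul_le_Lp_mul_Lq μ Real.HolderConjugate.two_two hf hg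
  have h2 : ∀ x : ℝ≥0∞, (x ^ (1 / 2 : ℝ)) ^ 2 = x := fun x => by
    rw [← ENNReal.rpow_natCast, ← ENNReal.rpow_mul]; norm_num
  calc (∫⁻ a, f a * g a ∂μ) ^ 2 ≤ _ := pow_le_pow_left' h 2
    _ = _ := by
      rw [mul_pow, h2, h2]
      simp only [ENNReal.rpow_two]

/-- Schur-type bound for convolution with the truncated kernel `1 / |z|`. -/
lemma lintegral_near_sq_le {h : R2 → ℝ≥0∞} (hh : Measurable h) (δ : ℝ) :
    ∫⁻ x, (∫⁻ z in ball (0 : R2) δ, h (x + z) * ‖z‖ₑ⁻¹) ^ 2 ≤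
      ENNReal.ofReal (2 * π * δ) ^ 2 * ∫⁻ x, h x ^ 2 := by
  have hk : ∀ k : ℝ≥0∞, (k ^ (1 / 2 : ℝ)) ^ 2 = k := fun x => by
    rw [← ENNReal.rpow_natCast, ← ENNReal.rpow_mul]; norm_num
  have h1 : ∀ x, (∫⁻ z in ball (0 : R2) δ, h (x + z) * ‖z‖ₑ⁻¹) ^ 2 ≤
      (∫⁻ z in ball (0 : R2) δ, h (x + z) ^ 2 * ‖z‖ₑ⁻¹) * ENNReal.ofReal (2 * π * δ) := by
    intro x
    rw [← lintegral_ball_inv_enorm δ]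
    have := sq_lintegral_mul_le (volume.restrict (ball (0 : R2) δ))
      (f := fun z => h (x + z) * (‖z‖ₑ⁻¹) ^ (1 / 2 : ℝ)) (g := fun z => (‖z‖ₑ⁻¹) ^ (1 / 2 : ℝ))
      (by fun_prop) (by fun_prop)
    simp only [mul_pow, hk] at this
    convert this using 4 with z
    rw [mul_assoc, ← pow_two, hk]
  calc _ ≤ ∫⁻ x, (∫⁻ z in ball (0 : R2) δ, h (x + z) ^ 2 * ‖z‖ₑ⁻¹) *
        ENNReal.ofReal (2 * π * δ) := lintegral_mono h1
    _ = (∫⁻ z in ball (0 : R2) δ, ∫⁻ x, h (x + z) ^ 2 * ‖z‖ₑ⁻¹) *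
        ENNReal.ofReal (2 * π * δ) := by
      rw [lintegral_mul_const' _ _ ENNReal.ofReal_ne_top, lintegral_lintegral_swap]
      exact Measurable.aemeasurable (by fun_prop)
    _ = (∫⁻ z in ball (0 : R2) δ, (∫⁻ x, h x ^ 2) * ‖z‖ₑ⁻¹) * ENNReal.ofReal (2 * π * δ) := by
      congr 1
      refine lintegral_congr fun z => ?_
      rw [lintegral_mul_const _ (by fun_prop),
        lintegral_add_right_eq_self (fun x => h x ^ 2) z]
    _ = _ := by
      rw [lintegral_const_mul _ (by fun_prop), lintegral_ball_inv_enorm]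
      ring

lemma enorm_le_near_add_far {v : R2 → ℝ} (hv : ContDiff ℝ 1 v) (hc : HasCompactSupport v)
    {R : ℝ} (hR : ∀ x ∈ tsupport v, ∀ y ∈ tsupport v, dist x y < R) {G : ℝ} (hG : 0 < G)
    (hGv : ∫⁻ x, ‖fderiv ℝ v x‖ₑ ^ 2 ≤ ENNReal.ofReal G) {s : ℝ} (hs : 0 ≤ s) (x : R2)
    (hx : v x ≠ 0) :
    ENNReal.ofReal (2 * π) * ‖v x‖ₑ ≤
      (∫⁻ z in ball (0 : R2) (R * Real.exp (-(2 * π * s ^ 2 / G))),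
        ‖fderiv ℝ v (x + z)‖ₑ * ‖z‖ₑ⁻¹) + ENNReal.ofReal (2 * π) * ENNReal.ofReal s := by
  set δ := R * Real.exp (-(2 * π * s ^ 2 / G)) with hδ
  have hxs : x ∈ tsupport v := subset_tsupport v hx
  have hR0 : 0 < R := by simpa using hR x hxs x hxs
  have hδ0 : 0 < δ := by positivity
  have hδR : δ ≤ R := by
    have : Real.exp (-(2 * π * s ^ 2 / G)) ≤ 1 := Real.exp_le_one_iff.2 (by
      have : 0 ≤ 2 * π * s ^ 2 / G := by positivity
      linarith)
    nlinarith
  have hcont : Continuous (fderiv ℝ v) := hv.continuous_fderiv (by simp)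
  have hlog : 2 * π * Real.log (R / δ) * G = (2 * π * s) ^ 2 := by
    have : R / δ = Real.exp (2 * π * s ^ 2 / G) := by
      rw [hδ, Real.exp_neg]; field_simp
    rw [this, Real.log_exp]; field_simp
  have hsupp : ∫⁻ z, ‖fderiv ℝ v (x + z)‖ₑ * ‖z‖ₑ⁻¹ =
      ∫⁻ z in ball (0 : R2) R, ‖fderiv ℝ v (x + z)‖ₑ * ‖z‖ₑ⁻¹ := by
    refine (setLIntegral_eq_of_support_subset fun z hz => ?_).symm
    have hz' : fderiv ℝ v (x + z) ≠ 0 := by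
      intro h0
      rw [Function.mem_support, h0] at hz
      exact hz (by rw [← ofReal_norm, norm_zero, ENNReal.ofReal_zero, zero_mul])
    have := hR x hxs (x + z) (support_fderiv_subset ℝ hz')
    simpa using this
  have hfar : ∫⁻ z in ball (0 : R2) R \ ball 0 δ, ‖fderiv ℝ v (x + z)‖ₑ * ‖z‖ₑ⁻¹ ≤
      ENNReal.ofReal (2 * π) * ENNReal.ofReal s := by
    have h1 := sq_lintegral_mul_le (volume.restrict (ball (0 : R2) R \ ball 0 δ))
      (f := fun z => ‖fderiv ℝ v (x + z)‖ₑ) (g := fun z => ‖z‖ₑ⁻¹)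
      (by fun_prop) (by fun_prop)
    rw [lintegral_annulus_inv_enorm_sq δ R hδ0 hδR] at h1
    have h2 : ∫⁻ z in ball (0 : R2) R \ ball 0 δ, ‖fderiv ℝ v (x + z)‖ₑ ^ 2 ≤
        ENNReal.ofReal G := by
      refine (setLIntegral_le_lintegral _ _).trans ?_
      rwa [lintegral_add_left_eq_self (fun z => ‖fderiv ℝ v z‖ₑ ^ 2) x]
    have h3 := h1.trans (mul_le_mul_left h2 _)
    rw [← ENNReal.ofReal_mul hG.le, mul_comm G, hlog, ENNReal.ofReal_pow (by positivity)] at h3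
    rw [← ENNReal.ofReal_mul (by positivity)]
    exact (ENNReal.pow_le_pow_left_iff two_ne_zero).1 h3
  refine (enorm_le_lintegral_fderiv hv hc x).trans ?_
  rw [hsupp, ← lintegral_inter_add_sdiff _ (ball (0 : R2) R) measurableSet_ball (B := ball 0 δ),
    inter_eq_right.2 (ball_subset_ball hδR)]
  gcongr

/-- Exponential decay of the truncated `L²` mass of a compactly supported `C¹` function. -/
lemma lintegral_sub_sq_le {v : R2 → ℝ} (hv : ContDiff ℝ 1 v) (hc : HasCompactSupport v)
    {R : ℝ} (hR : ∀ x ∈ tsupport v, ∀ y ∈ tsupport v, dist x y < R) {G : ℝ} (hG : 0 < G)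
    (hGv : ∫⁻ x, ‖fderiv ℝ v x‖ₑ ^ 2 ≤ ENNReal.ofReal G) {s : ℝ} (hs : 0 ≤ s) :
    ∫⁻ x, (‖v x‖ₑ - ENNReal.ofReal s) ^ 2 ≤
      ENNReal.ofReal (R ^ 2 * G * Real.exp (-(4 * π * s ^ 2 / G))) := by
  have hcont : Continuous (fderiv ℝ v) := hv.continuous_fderiv (by simp)
  set δ := R * Real.exp (-(2 * π * s ^ 2 / G)) with hδ
  by_cases hne : tsupport v = ∅
  · have : v = 0 := tsupport_eq_empty_iff.1 hne
    simp [this]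
  obtain ⟨x₀, hx₀⟩ := nonempty_iff_ne_empty.2 hne
  have hR0 : 0 < R := by simpa using hR x₀ hx₀ x₀ hx₀
  have hδ0 : 0 < δ := by positivity
  have hpt : ∀ x, ENNReal.ofReal (2 * π) * (‖v x‖ₑ - ENNReal.ofReal s) ≤
      ∫⁻ z in ball (0 : R2) δ, ‖fderiv ℝ v (x + z)‖ₑ * ‖z‖ₑ⁻¹ := by
    intro x
    by_cases hx : v x = 0
    · simp [hx]
    rw [ENNReal.mul_sub (fun _ _ => ENNReal.ofReal_ne_top)]
    exact tsub_le_iff_right.2 (enorm_le_near_add_far hv hc hR hG hGv hs x hx)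
  have h1 : ENNReal.ofReal (2 * π) ^ 2 * ∫⁻ x, (‖v x‖ₑ - ENNReal.ofReal s) ^ 2 ≤
      ENNReal.ofReal (2 * π) ^ 2 *
        ENNReal.ofReal (R ^ 2 * G * Real.exp (-(4 * π * s ^ 2 / G))) := by
    have hvc := hv.continuous
    rw [← lintegral_const_mul _ (by fun_prop)]
    calc _ ≤ ∫⁻ x, (∫⁻ z in ball (0 : R2) δ, ‖fderiv ℝ v (x + z)‖ₑ * ‖z‖ₑ⁻¹) ^ 2 := by
          refine lintegral_mono fun x => ?_
          simp only [← mul_pow]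
          exact pow_le_pow_left' (hpt x) 2
      _ ≤ ENNReal.ofReal (2 * π * δ) ^ 2 * ∫⁻ x, ‖fderiv ℝ v x‖ₑ ^ 2 :=
          lintegral_near_sq_le (h := fun x => ‖fderiv ℝ v x‖ₑ) (by fun_prop) δ
      _ ≤ ENNReal.ofReal (2 * π * δ) ^ 2 * ENNReal.ofReal G := by gcongr
      _ = _ := by
          rw [← ENNReal.ofReal_pow (by positivity), ← ENNReal.ofReal_pow (by positivity),
            ← ENNReal.ofReal_mul (by positivity), ← ENNReal.ofReal_mul (by positivity)]
          congr 1
          have : Real.exp (-(4 * π * s ^ 2 / G)) = Real.exp (-(2 * π * s ^ 2 / G)) ^ 2 := by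
            rw [← Real.exp_nat_mul]; congr 1; push_cast; ring
          rw [this, hδ]; ring
  exact (ENNReal.mul_le_mul_iff_right (by simp [Real.pi_pos])
    (ENNReal.pow_ne_top ENNReal.ofReal_ne_top)).1 h1

lemma integral_sub_sq_mul_rpow {p a : ℝ} (hp : 2 < p) (ha : 0 < a) :
    ∫ s in (0 : ℝ)..a, (a - s) ^ 2 * s ^ (p - 2) =
      2 / ((p - 1) * p * (p + 1)) * a ^ (p + 1) := by
  have e : ∀ s ∈ Ioc (0 : ℝ) a, (a - s) ^ 2 * s ^ (p - 2) =
      a ^ 2 * s ^ (p - 2) - 2 * a * s ^ (p - 1) + s ^ p := by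
    intro s hs
    have h1 : s ^ (p - 1) = s ^ (p - 2) * s := by
      rw [← Real.rpow_add_one hs.1.ne']; ring_nf
    have h2 : s ^ p = s ^ (p - 2) * s * s := by
      rw [← Real.rpow_add_one hs.1.ne', ← Real.rpow_add_one hs.1.ne']; ring_nf
    rw [h1, h2]; ring
  have hi : ∀ r : ℝ, -1 < r → IntervalIntegrable (fun s : ℝ => s ^ r) volume 0 a :=
    fun r hr => intervalIntegral.intervalIntegrable_rpow' hr
  rw [intervalIntegral.integral_of_le ha.le, setIntegral_congr_fun measurableSet_Ioc e,
    ← intervalIntegral.integral_of_le ha.le, intervalIntegral.integral_add,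
    intervalIntegral.integral_sub, intervalIntegral.integral_const_mul,
    intervalIntegral.integral_const_mul, integral_rpow (Or.inl (by linarith)),
    integral_rpow (Or.inl (by linarith)), integral_rpow (Or.inl (by linarith)),
    Real.zero_rpow (by linarith), Real.zero_rpow (by linarith), Real.zero_rpow (by linarith)]
  · have h1 : a ^ (p - 1 + 1) = a ^ (p - 2 + 1) * a := by
      rw [← Real.rpow_add_one ha.ne']; ring_nf
    have h2 : a ^ (p + 1) = a ^ (p - 2 + 1) * a * a := by
      rw [← Real.rpow_add_one ha.ne', ← Real.rpow_add_one ha.ne']; ring_nf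
    rw [h1, h2]
    have : p - 1 ≠ 0 := by linarith
    have : p - 2 + 1 ≠ 0 := by linarith
    have : p - 1 + 1 ≠ 0 := by linarith
    have : p ≠ 0 := by linarith
    have : p + 1 ≠ 0 := by linarith
    rw [show p - 2 + 1 = p - 1 by ring, show p - 1 + 1 = p by ring]
    field_simp
    ring
  · exact (hi _ (by linarith)).const_mul _
  · exact (hi _ (by linarith)).const_mul _
  · exact ((hi _ (by linarith)).const_mul _).sub ((hi _ (by linarith)).const_mul _)
  · exact hi _ (by linarith)

lemma rpow_le_lintegral_sub_sq {p a : ℝ} (hp : 2 < p) (ha : 0 ≤ a) :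
    ENNReal.ofReal (2 / ((p - 1) * p * (p + 1))) * ENNReal.ofReal a ^ (p + 1) ≤
      ∫⁻ s in Ioi (0 : ℝ), (ENNReal.ofReal a - ENNReal.ofReal s) ^ 2 *
        ENNReal.ofReal (s ^ (p - 2)) := by
  rcases ha.eq_or_lt with rfl | ha
  · simp [ENNReal.zero_rpow_of_pos (by linarith : 0 < p + 1)]
  have hc : (0 : ℝ) ≤ 2 / ((p - 1) * p * (p + 1)) :=
    div_nonneg (by norm_num) (mul_nonneg (mul_nonneg (by linarith) (by linarith)) (by linarith))
  have hcont : ContinuousOn (fun s : ℝ => (a - s) ^ 2 * s ^ (p - 2)) (uIcc 0 a) := by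
    refine ContinuousOn.mul (by fun_prop) ?_
    exact (Real.continuous_rpow_const (by linarith)).continuousOn
  calc _ = ENNReal.ofReal (∫ s in (0 : ℝ)..a, (a - s) ^ 2 * s ^ (p - 2)) := by
        rw [integral_sub_sq_mul_rpow hp ha, ENNReal.ofReal_mul hc,
          ENNReal.ofReal_rpow_of_pos ha]
    _ = ∫⁻ s in Ioc 0 a, ENNReal.ofReal ((a - s) ^ 2 * s ^ (p - 2)) := by
        rw [intervalIntegral.integral_of_le ha.le,
          ofReal_integral_eq_lintegral_ofReal hcont.intervalIntegrable.1]
        filter_upwards [ae_restrict_mem measurableSet_Ioc] with s hs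
        exact mul_nonneg (sq_nonneg _) (Real.rpow_nonneg hs.1.le _)
    _ = ∫⁻ s in Ioc 0 a, (ENNReal.ofReal a - ENNReal.ofReal s) ^ 2 *
          ENNReal.ofReal (s ^ (p - 2)) := by
        refine setLIntegral_congr_fun measurableSet_Ioc fun s hs => ?_
        rw [ENNReal.ofReal_mul (sq_nonneg _), ENNReal.ofReal_pow (by linarith [hs.2]),
          ENNReal.ofReal_sub _ hs.1.le]
    _ ≤ _ := lintegral_mono_set Ioc_subset_Ioi_self

lemma mul_lintegral_rpow_le {v : R2 → ℝ} (hv : ContDiff ℝ 1 v) (hc : HasCompactSupport v)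
    {R : ℝ} (hR : ∀ x ∈ tsupport v, ∀ y ∈ tsupport v, dist x y < R) {G : ℝ} (hG : 0 < G)
    (hGv : ∫⁻ x, ‖fderiv ℝ v x‖ₑ ^ 2 ≤ ENNReal.ofReal G) {p : ℝ} (hp : 2 < p) :
    ENNReal.ofReal (2 / ((p - 1) * p * (p + 1))) * ∫⁻ x, ‖v x‖ₑ ^ (p + 1) ≤
      ∫⁻ s in Ioi (0 : ℝ), ENNReal.ofReal (R ^ 2 * G * Real.exp (-(4 * π * s ^ 2 / G))) *
        ENNReal.ofReal (s ^ (p - 2)) := by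
  have hvc := hv.continuous
  have hm : Measurable fun s : ℝ => ENNReal.ofReal (s ^ (p - 2)) := by fun_prop
  rw [← lintegral_const_mul _ (by fun_prop)]
  calc _ ≤ ∫⁻ x, ∫⁻ s in Ioi (0 : ℝ), (‖v x‖ₑ - ENNReal.ofReal s) ^ 2 *
        ENNReal.ofReal (s ^ (p - 2)) := by
        refine lintegral_mono fun x => ?_
        have := rpow_le_lintegral_sub_sq hp (norm_nonneg (v x))
        rwa [ofReal_norm] at this
    _ = ∫⁻ s in Ioi (0 : ℝ), ∫⁻ x, (‖v x‖ₑ - ENNReal.ofReal s) ^ 2 *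
        ENNReal.ofReal (s ^ (p - 2)) := by
        rw [lintegral_lintegral_swap]
        have hvm : Measurable v := hvc.measurable
        exact Measurable.aemeasurable (by fun_prop)
    _ ≤ _ := by
        refine setLIntegral_mono' measurableSet_Ioi fun s hs => ?_
        rw [lintegral_mul_const' _ _ ENNReal.ofReal_ne_top]
        gcongr
        exact lintegral_sub_sq_le hv hc hR hG hGv (le_of_lt hs)

lemma rpow_mul_exp_le {p G s : ℝ} (hp : 2 < p) (hG : 0 < G)
    (hGp : G ≤ 6 * π * Real.exp 1 / p) (hs : 0 < s) :
    Real.exp (-(4 * π * s ^ 2 / G)) * s ^ (p - 2) ≤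
      (3 / 4) ^ ((p - 2) / 2) * Real.exp (-(4 / (3 * Real.exp 1)) * s ^ 2) := by
  set b := 4 / (3 * Real.exp 1) with hb
  have he := Real.exp_pos 1
  have hb0 : 0 < b := by positivity
  have h1 : b * s ^ 2 * (p / 2) ≤ 4 * π * s ^ 2 / G := by
    rw [le_div_iff₀ hG]
    have : G * p ≤ 6 * π * Real.exp 1 := (le_div_iff₀ (by linarith)).1 hGp
    have h2 : b * s ^ 2 * (p / 2) * G = (b / 2 * s ^ 2) * (G * p) := by ring
    rw [h2]
    calc _ ≤ (b / 2 * s ^ 2) * (6 * π * Real.exp 1) := by gcongr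
      _ = _ := by rw [hb]; field_simp; norm_num
  have h2 : s ^ 2 ≤ 3 / 4 * Real.exp (b * s ^ 2) := by
    have := Real.add_one_le_exp (b * s ^ 2 - 1)
    rw [Real.exp_sub, le_div_iff₀ he] at this
    have h3 : b * s ^ 2 * Real.exp 1 = 4 / 3 * s ^ 2 := by rw [hb]; field_simp
    nlinarith
  have h3 : s ^ (p - 2) ≤ (3 / 4) ^ ((p - 2) / 2) * Real.exp (b * s ^ 2 * ((p - 2) / 2)) := by
    have e1 : s ^ (p - 2) = (s ^ 2) ^ ((p - 2) / 2) := by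
      rw [← Real.rpow_natCast, ← Real.rpow_mul hs.le]; congr 1; push_cast; ring
    rw [e1, Real.exp_mul, ← Real.mul_rpow (by norm_num) (Real.exp_pos _).le]
    exact Real.rpow_le_rpow (sq_nonneg s) h2 (by linarith)
  calc _ ≤ Real.exp (-(b * s ^ 2 * (p / 2))) *
        ((3 / 4) ^ ((p - 2) / 2) * Real.exp (b * s ^ 2 * ((p - 2) / 2))) := by
        gcongr
    _ = _ := by
        rw [mul_left_comm, ← Real.exp_add]; congr 2; ring

/-- Subcritical form of the sharp Sobolev inequality in the plane as `p → ∞`. -/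
lemma mul_lintegral_rpow_le_of_le {v : R2 → ℝ} (hv : ContDiff ℝ 1 v) (hc : HasCompactSupport v)
    {R : ℝ} (hR : ∀ x ∈ tsupport v, ∀ y ∈ tsupport v, dist x y < R) {G : ℝ} (hG : 0 < G)
    (hGv : ∫⁻ x, ‖fderiv ℝ v x‖ₑ ^ 2 ≤ ENNReal.ofReal G) {p : ℝ} (hp : 2 < p)
    (hGp : G ≤ 6 * π * Real.exp 1 / p) :
    ENNReal.ofReal (2 / ((p - 1) * p * (p + 1))) * ∫⁻ x, ‖v x‖ₑ ^ (p + 1) ≤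
      ENNReal.ofReal (R ^ 2 * (3 / 4) ^ ((p - 2) / 2) *
        (√(π / (4 / (3 * Real.exp 1))) / 2)) * ENNReal.ofReal G := by
  refine (mul_lintegral_rpow_le hv hc hR hG hGv hp).trans ?_
  have hb0 : 0 < 4 / (3 * Real.exp 1) := by positivity
  calc _ ≤ ∫⁻ s in Ioi (0 : ℝ), ENNReal.ofReal (R ^ 2 * G * (3 / 4) ^ ((p - 2) / 2)) *
        ENNReal.ofReal (Real.exp (-(4 / (3 * Real.exp 1)) * s ^ 2)) := by
        refine setLIntegral_mono' measurableSet_Ioi fun s hs => ?_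
        rw [← ENNReal.ofReal_mul (by positivity), ← ENNReal.ofReal_mul (by positivity)]
        apply ENNReal.ofReal_le_ofReal
        rw [mul_assoc, mul_assoc (R ^ 2 * G)]
        exact mul_le_mul_of_nonneg_left (rpow_mul_exp_le hp hG hGp hs) (by positivity)
    _ = _ := by
        rw [lintegral_const_mul _ (by fun_prop), ← ofReal_integral_eq_lintegral_ofReal
          (integrable_exp_neg_mul_sq hb0).integrableOn (ae_of_all _ fun s => (Real.exp_pos _).le),
          integral_gaussian_Ioi, ← ENNReal.ofReal_mul (by positivity),
          ← ENNReal.ofReal_mul (by positivity)]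
        congr 1
        ring

/-- Derivative of the `C¹` truncation `softTrunc`. -/
def softTruncDeriv (ε t : ℝ) : ℝ := max 0 (min 1 (|t| / ε - 1))

/-- An odd `C¹` truncation of the identity vanishing on `[-ε, ε]`. -/
def softTrunc (ε t : ℝ) : ℝ := ∫ τ in (0 : ℝ)..t, softTruncDeriv ε τ

lemma continuous_softTruncDeriv (ε : ℝ) : Continuous (softTruncDeriv ε) := by
  unfold softTruncDeriv; fun_prop

lemma softTruncDeriv_nonneg (ε t : ℝ) : 0 ≤ softTruncDeriv ε t := le_max_left _ _

lemma softTruncDeriv_le_one (ε t : ℝ) : softTruncDeriv ε t ≤ 1 :=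
  max_le zero_le_one (min_le_left _ _)

lemma softTruncDeriv_eq_zero {ε t : ℝ} (hε : 0 < ε) (ht : |t| ≤ ε) : softTruncDeriv ε t = 0 := by
  refine max_eq_left ((min_le_right _ _).trans ?_)
  rw [sub_nonpos, div_le_one hε]; exact ht

lemma softTruncDeriv_eq_one {ε t : ℝ} (hε : 0 < ε) (ht : 2 * ε ≤ |t|) :
    softTruncDeriv ε t = 1 := by
  have : 2 ≤ |t| / ε := (le_div_iff₀ hε).2 ht
  rw [softTruncDeriv, min_eq_left (by linarith), max_eq_right zero_le_one]

lemma hasDerivAt_softTrunc (ε t : ℝ) : HasDerivAt (softTrunc ε) (softTruncDeriv ε t) t :=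
  (continuous_softTruncDeriv ε).integral_hasStrictDerivAt 0 t |>.hasDerivAt

lemma contDiff_softTrunc (ε : ℝ) : ContDiff ℝ 1 (softTrunc ε) := by
  rw [contDiff_one_iff_deriv]
  refine ⟨fun t => (hasDerivAt_softTrunc ε t).differentiableAt, ?_⟩
  have : deriv (softTrunc ε) = softTruncDeriv ε := funext fun t => (hasDerivAt_softTrunc ε t).deriv
  rw [this]; exact continuous_softTruncDeriv ε

lemma softTrunc_neg (ε t : ℝ) : softTrunc ε (-t) = -softTrunc ε t := by
  have h := intervalIntegral.integral_comp_neg (a := 0) (b := t) (softTruncDeriv ε)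
  have h2 : ∀ τ, softTruncDeriv ε (-τ) = softTruncDeriv ε τ := fun τ => by simp [softTruncDeriv]
  simp only [h2, neg_zero] at h
  rw [softTrunc, softTrunc, h, intervalIntegral.integral_symm]

lemma softTrunc_nonneg (ε : ℝ) {t : ℝ} (ht : 0 ≤ t) : 0 ≤ softTrunc ε t :=
  intervalIntegral.integral_nonneg ht fun τ _ => softTruncDeriv_nonneg ε τ

lemma softTrunc_le (ε : ℝ) {t : ℝ} (ht : 0 ≤ t) : softTrunc ε t ≤ t := by
  have := intervalIntegral.integral_mono_on ht
    ((continuous_softTruncDeriv ε).intervalIntegrable (μ := volume) 0 t) (intervalIntegrable_const (c := (1 : ℝ)))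
    fun τ _ => softTruncDeriv_le_one ε τ
  simpa [softTrunc] using this

lemma sub_le_softTrunc {ε : ℝ} (hε : 0 < ε) {t : ℝ} (ht : 0 ≤ t) :
    t - 2 * ε ≤ softTrunc ε t := by
  rcases le_total t (2 * ε) with h | h
  · linarith [softTrunc_nonneg ε ht]
  · have hi := fun a b => (continuous_softTruncDeriv ε).intervalIntegrable (μ := volume) a b
    have h1 : softTrunc ε t = softTrunc ε (2 * ε) + ∫ τ in (2 * ε)..t, softTruncDeriv ε τ :=
      (intervalIntegral.integral_add_adjacent_intervals (hi _ _) (hi _ _)).symm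
    have h2 := intervalIntegral.integral_mono_on h (intervalIntegrable_const (c := (1 : ℝ)))
      (hi _ _) (fun τ hτ => (softTruncDeriv_eq_one hε (hτ.1.trans (le_abs_self τ))).ge)
    rw [intervalIntegral.integral_const, smul_eq_mul, mul_one] at h2
    linarith [softTrunc_nonneg ε (by linarith : (0 : ℝ) ≤ 2 * ε)]

lemma abs_softTrunc (ε t : ℝ) : |softTrunc ε t| = softTrunc ε |t| := by
  rcases le_total 0 t with h | h
  · rw [abs_of_nonneg h, abs_of_nonneg (softTrunc_nonneg ε h)]
  · rw [abs_of_nonpos h, softTrunc_neg, abs_of_nonpos]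
    have := softTrunc_nonneg ε (neg_nonneg.2 h)
    rw [softTrunc_neg] at this; linarith

lemma softTrunc_mul_self (ε t : ℝ) : softTrunc ε t * t = softTrunc ε |t| * |t| := by
  rcases le_total 0 t with h | h
  · rw [abs_of_nonneg h]
  · rw [abs_of_nonpos h, softTrunc_neg]; ring

lemma softTrunc_eq_zero {ε t : ℝ} (hε : 0 < ε) (ht : |t| ≤ ε) : softTrunc ε t = 0 := by
  rw [softTrunc, intervalIntegral.integral_congr (g := fun _ => (0 : ℝ))]
  · simp
  · intro τ hτ
    refine softTruncDeriv_eq_zero hε (le_trans ?_ ht)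
    simpa using abs_sub_left_of_mem_uIcc hτ

lemma tendsto_softTrunc {ε : ℕ → ℝ} (hε : ∀ n, 0 < ε n) (h0 : Tendsto ε atTop (𝓝 0)) {t : ℝ}
    (ht : 0 ≤ t) : Tendsto (fun n => softTrunc (ε n) t) atTop (𝓝 t) := by
  refine tendsto_of_tendsto_of_tendsto_of_le_of_le (g := fun n => t - 2 * ε n) ?_
    tendsto_const_nhds (fun n => sub_le_softTrunc (hε n) ht) (fun n => softTrunc_le _ ht)
  simpa using tendsto_const_nhds.sub (h0.const_mul 2)

section Indicator

variable {F : Type*} [NormedAddCommGroup F] {W K : Set R2} {f : R2 → F}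

lemma indicator_eventuallyEq_zero (hK : IsCompact K) (h0 : ∀ x ∈ W, x ∉ K → f x = 0) {x : R2}
    (hx : x ∉ K) : W.indicator f =ᶠ[𝓝 x] fun _ => 0 := by
  filter_upwards [hK.isClosed.isOpen_compl.mem_nhds hx] with y hy
  by_cases hyW : y ∈ W
  · simp [hyW, h0 y hyW hy]
  · simp [hyW]

lemma tsupport_indicator_subset (hK : IsCompact K) (h0 : ∀ x ∈ W, x ∉ K → f x = 0) :
    tsupport (W.indicator f) ⊆ K := by
  refine closure_minimal (fun x hx => ?_) hK.isClosed
  by_contra h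
  exact hx (indicator_eventuallyEq_zero hK h0 h).self_of_nhds

lemma hasCompactSupport_indicator (hK : IsCompact K) (h0 : ∀ x ∈ W, x ∉ K → f x = 0) :
    HasCompactSupport (W.indicator f) :=
  hK.of_isClosed_subset (isClosed_tsupport _) (tsupport_indicator_subset hK h0)

lemma contDiff_indicator [NormedSpace ℝ F] (hW : IsOpen W) (hK : IsCompact K) (hKW : K ⊆ W)
    (h0 : ∀ x ∈ W, x ∉ K → f x = 0) {n : ℕ∞} (hf : ContDiffOn ℝ n f W) :
    ContDiff ℝ n (W.indicator f) := by
  rw [contDiff_iff_contDiffAt]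
  intro x
  by_cases hx : x ∈ K
  · have hxW := hW.mem_nhds (hKW hx)
    exact (hf.contDiffAt hxW).congr_of_eventuallyEq
      (by filter_upwards [hxW] with y hy using indicator_of_mem hy f)
  · exact contDiffAt_const.congr_of_eventuallyEq (indicator_eventuallyEq_zero hK h0 hx)

lemma fderiv_indicator [NormedSpace ℝ F] (hW : IsOpen W) (hK : IsCompact K) (hKW : K ⊆ W)
    (h0 : ∀ x ∈ W, x ∉ K → f x = 0) (x : R2) :
    fderiv ℝ (W.indicator f) x = W.indicator (fderiv ℝ f) x := by
  by_cases hx : x ∈ W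
  · rw [indicator_of_mem hx]
    refine Filter.EventuallyEq.fderiv_eq ?_
    filter_upwards [hW.mem_nhds hx] with y hy using indicator_of_mem hy f
  · rw [indicator_of_notMem hx,
      (indicator_eventuallyEq_zero hK h0 (fun h => hx (hKW h))).fderiv_eq]
    simp

end Indicator

lemma integral_fderiv_eq_zero {f : R2 → ℝ} (hf : ContDiff ℝ 1 f) (hc : HasCompactSupport f)
    (e : R2) : ∫ x, fderiv ℝ f x e = 0 := by
  have hcont : Continuous fun x => fderiv ℝ f x e :=
    (hf.continuous_fderiv (by simp)).clm_apply continuous_const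
  have hi : Integrable fun x => fderiv ℝ f x e :=
    hcont.integrable_of_hasCompactSupport (hc.fderiv_apply (𝕜 := ℝ) e)
  have := integral_mul_fderiv_eq_neg_fderiv_mul_of_integrable (μ := (volume : Measure R2))
    (f := fun _ => (1 : ℝ)) (g := f) (v := e) (by simp) (by simpa using hi)
    (by simpa using hf.continuous.integrable_of_hasCompactSupport hc)
    (fun x _ => differentiableAt_const _) (fun x _ => hf.differentiable (by simp) x)
  simpa using this

lemma norm_fderiv_sq_eq_sum (u : R2 → ℝ) (x : R2) :
    ‖fderiv ℝ u x‖ ^ 2 = ∑ i : Fin 2, fderiv ℝ u x (EuclideanSpace.single i 1) ^ 2 := by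
  have h1 : ‖gradient u x‖ = ‖fderiv ℝ u x‖ := by simp [gradient]
  rw [← h1, EuclideanSpace.norm_sq_eq]
  refine Finset.sum_congr rfl fun i _ => ?_
  have h2 : fderiv ℝ u x (EuclideanSpace.single i 1) = gradient u x i := by
    have : inner ℝ (gradient u x) (EuclideanSpace.single i (1 : ℝ)) =
        fderiv ℝ u x (EuclideanSpace.single i 1) := by
      simp [gradient]
    rw [← this, EuclideanSpace.inner_single_right]
    simp
  rw [h2, Real.norm_eq_abs, sq_abs]

/-- An open set on which `u` solves the Lane–Emden equation and whose superlevel sets of `|u|`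
are compact, such as a nodal domain of a solution vanishing on the boundary. -/
structure IsNodalRegion (W : Set R2) (p : ℝ) (u : R2 → ℝ) : Prop where
  isOpen : IsOpen W
  contDiffOn : ContDiffOn ℝ 2 u W
  equation : ∀ x ∈ W, -lap u x = |u x| ^ (p - 1) * u x
  isCompact : ∀ ε > 0, IsCompact {x ∈ W | ε ≤ |u x|}

namespace IsNodalRegion

variable {W : Set R2} {p : ℝ} {u : R2 → ℝ}

lemma softTrunc_eq_zero {ε : ℝ} (hε : 0 < ε) :
    ∀ x ∈ W, x ∉ {x ∈ W | ε ≤ |u x|} → softTrunc ε (u x) = 0 := fun _ hx hxK =>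
  _root_.softTrunc_eq_zero hε (le_of_lt (not_le.1 fun h => hxK ⟨hx, h⟩))

lemma contDiffOn_fderiv_apply (h : IsNodalRegion W p u) (e : R2) :
    ContDiffOn ℝ 1 (fun x => fderiv ℝ u x e) W :=
  (h.contDiffOn.fderiv_of_isOpen h.isOpen (by norm_num)).clm_apply contDiffOn_const

lemma contDiffOn_softTrunc (h : IsNodalRegion W p u) (ε : ℝ) :
    ContDiffOn ℝ 1 (fun x => softTrunc ε (u x)) W :=
  (contDiff_softTrunc ε).comp_contDiffOn (h.contDiffOn.of_le (by norm_num))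

lemma hasFDerivAt (h : IsNodalRegion W p u) {x : R2} (hx : x ∈ W) :
    HasFDerivAt u (fderiv ℝ u x) x :=
  ((h.contDiffOn.contDiffAt (h.isOpen.mem_nhds hx)).differentiableAt (by norm_num)).hasFDerivAt

lemma hasFDerivAt_softTrunc (h : IsNodalRegion W p u) (ε : ℝ) {x : R2} (hx : x ∈ W) :
    HasFDerivAt (fun x => softTrunc ε (u x)) (softTruncDeriv ε (u x) • fderiv ℝ u x) x :=
  (hasDerivAt_softTrunc ε (u x)).comp_hasFDerivAt x (h.hasFDerivAt hx)

lemma sum_fderiv_flux (h : IsNodalRegion W p u) (ε : ℝ) {x : R2} (hx : x ∈ W) :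
    ∑ i : Fin 2, fderiv ℝ (fun y => softTrunc ε (u y) *
        fderiv ℝ u y (EuclideanSpace.single i 1)) x (EuclideanSpace.single i 1) =
      softTruncDeriv ε (u x) * ‖fderiv ℝ u x‖ ^ 2 -
        softTrunc ε (u x) * (|u x| ^ (p - 1) * u x) := by
  rw [← h.equation x hx, norm_fderiv_sq_eq_sum, lap]
  have : ∀ i : Fin 2, fderiv ℝ (fun y => softTrunc ε (u y) *
        fderiv ℝ u y (EuclideanSpace.single i 1)) x (EuclideanSpace.single i 1) =
      softTruncDeriv ε (u x) * fderiv ℝ u x (EuclideanSpace.single i 1) ^ 2 +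
      softTrunc ε (u x) * fderiv ℝ (fun y => fderiv ℝ u y (EuclideanSpace.single i 1)) x
        (EuclideanSpace.single i 1) := by
    intro i
    have hd := (((h.contDiffOn_fderiv_apply (EuclideanSpace.single i 1)).contDiffAt
      (h.isOpen.mem_nhds hx)).differentiableAt (by norm_num)).hasFDerivAt
    have hm := ((h.hasFDerivAt_softTrunc ε hx).mul hd).fderiv
    simp only [Pi.mul_def] at hm
    rw [hm]
    simp
    ring
  simp_rw [this]
  rw [Finset.sum_add_distrib, ← Finset.mul_sum, ← Finset.mul_sum]
  ring

/-- Testing the equation with the truncation of `u` on the region. -/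
lemma lintegral_softTruncDeriv_mul (h : IsNodalRegion W p u) (hp : 1 < p) {ε : ℝ} (hε : 0 < ε) :
    ∫⁻ x in W, ENNReal.ofReal (softTruncDeriv ε (u x) * ‖fderiv ℝ u x‖ ^ 2) =
      ∫⁻ x in W, ENNReal.ofReal (softTrunc ε (u x) * (|u x| ^ (p - 1) * u x)) := by
  have hK := h.isCompact ε hε
  have hKW : {x ∈ W | ε ≤ |u x|} ⊆ W := fun x hx => hx.1
  have hz := softTrunc_eq_zero (W := W) (u := u) hε
  set A : R2 → ℝ := fun x => softTruncDeriv ε (u x) * ‖fderiv ℝ u x‖ ^ 2 with hA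
  set B : R2 → ℝ := fun x => softTrunc ε (u x) * (|u x| ^ (p - 1) * u x) with hB
  have hA0 : ∀ x ∈ W, x ∉ {x ∈ W | ε ≤ |u x|} → A x = 0 := fun x hx hxK => by
    simp [hA, softTruncDeriv_eq_zero hε (le_of_lt (not_le.1 fun h => hxK ⟨hx, h⟩))]
  have hB0 : ∀ x ∈ W, x ∉ {x ∈ W | ε ≤ |u x|} → B x = 0 := fun x hx hxK => by
    simp [hB, hz x hx hxK]
  have huc : ContinuousOn u W := h.contDiffOn.continuousOn
  have hAc : ContinuousOn A W :=
    ((continuous_softTruncDeriv ε).comp_continuousOn huc).mul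
      ((h.contDiffOn.continuousOn_fderiv_of_isOpen h.isOpen (by norm_num)).norm.pow 2)
  have hBc : ContinuousOn B W :=
    ((contDiff_softTrunc ε).continuous.comp_continuousOn huc).mul
      ((huc.abs.rpow_const fun x _ => Or.inr (by linarith)).mul huc)
  have key : ∀ {f : R2 → ℝ}, ContinuousOn f W →
      (∀ x ∈ W, x ∉ {x ∈ W | ε ≤ |u x|} → f x = 0) → Integrable (W.indicator f) := by
    intro f hf hf0
    refine Continuous.integrable_of_hasCompactSupport ?_ (hasCompactSupport_indicator hK hf0)
    exact (contDiff_indicator (n := 0) h.isOpen hK hKW hf0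
      (by simpa using contDiffOn_zero (𝕜 := ℝ).2 hf)).continuous
  have hAi := key hAc hA0
  have hBi := key hBc hB0
  have hint : ∫ x, W.indicator A x = ∫ x, W.indicator B x := by
    rw [← sub_eq_zero, ← integral_sub hAi hBi]
    let V : Fin 2 → R2 → ℝ := fun i y => softTrunc ε (u y) *
        fderiv ℝ u y (EuclideanSpace.single i 1)
    have hV0 : ∀ i, ∀ x ∈ W, x ∉ {x ∈ W | ε ≤ |u x|} → V i x = 0 := fun i x hx hxK => by
      simp [V, hz x hx hxK]
    have hV : ∀ i, ContDiff ℝ 1 (W.indicator (V i)) := fun i =>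
      contDiff_indicator (n := 1) h.isOpen hK hKW (hV0 i)
        ((h.contDiffOn_softTrunc ε).mul (h.contDiffOn_fderiv_apply _))
    have hVc : ∀ i, HasCompactSupport (W.indicator (V i)) := fun i =>
      hasCompactSupport_indicator hK (hV0 i)
    have e : ∀ x, W.indicator A x - W.indicator B x = ∑ i : Fin 2,
        fderiv ℝ (W.indicator (V i)) x (EuclideanSpace.single i 1) := by
      intro x
      simp_rw [fun i => fderiv_indicator h.isOpen hK hKW (hV0 i) x]
      by_cases hx : x ∈ W
      · simp only [indicator_of_mem hx]
        exact (h.sum_fderiv_flux ε hx).symm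
      · simp [hx]
    simp_rw [e]
    rw [integral_finsetSum]
    · exact Finset.sum_eq_zero fun i _ => integral_fderiv_eq_zero (hV i) (hVc i) _
    · intro i _
      exact (((hV i).continuous_fderiv (by simp)).clm_apply
        continuous_const).integrable_of_hasCompactSupport ((hVc i).fderiv_apply (𝕜 := ℝ) _)
  have hAn : ∀ x, 0 ≤ A x := fun x => mul_nonneg (softTruncDeriv_nonneg _ _) (sq_nonneg _)
  have hBn : ∀ x, 0 ≤ B x := fun x => by
    have : B x = |u x| ^ (p - 1) * (softTrunc ε (u x) * u x) := by simp only [hB]; ring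
    rw [this, softTrunc_mul_self]
    exact mul_nonneg (Real.rpow_nonneg (abs_nonneg _) _)
      (mul_nonneg (softTrunc_nonneg ε (abs_nonneg _)) (abs_nonneg _))
  have conv : ∀ {f : R2 → ℝ}, (∀ x, 0 ≤ f x) → Integrable (W.indicator f) →
      ∫⁻ x in W, ENNReal.ofReal (f x) = ENNReal.ofReal (∫ x, W.indicator f x) := by
    intro f hf hfi
    rw [ofReal_integral_eq_lintegral_ofReal hfi
      (ae_of_all _ fun x => indicator_nonneg (fun x _ => hf x) x),
      ← lintegral_indicator h.isOpen.measurableSet]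
    refine lintegral_congr fun x => ?_
    by_cases hx : x ∈ W <;> simp [hx]
  rw [conv hAn hAi, conv hBn hBi, hint]

end IsNodalRegion

lemma enorm_rpow_eq_ofReal {q : ℝ} (hq : 0 ≤ q) (t : ℝ) :
    ‖t‖ₑ ^ q = ENNReal.ofReal (|t| ^ q) := by
  rw [← ofReal_norm, Real.norm_eq_abs, ENNReal.ofReal_rpow_of_nonneg (abs_nonneg _) hq]

lemma softTrunc_mul_rpow_mul (ε p t : ℝ) :
    softTrunc ε t * (|t| ^ (p - 1) * t) = |t| ^ (p - 1) * (softTrunc ε |t| * |t|) := by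
  rw [← softTrunc_mul_self]; ring

lemma abs_rpow_mul_sq {p : ℝ} (hp : 1 < p) (t : ℝ) :
    |t| ^ (p - 1) * (|t| * |t|) = |t| ^ (p + 1) := by
  rw [← pow_two, ← Real.rpow_natCast, ← Real.rpow_add_of_nonneg (abs_nonneg _) (by linarith)
    (by norm_num)]
  congr 1; push_cast; ring

lemma lintegral_le_of_tendsto {α : Type*} [MeasurableSpace α] {μ : Measure α}
    {f : ℕ → α → ℝ≥0∞} {g : α → ℝ≥0∞} {c : ℝ≥0∞} (hf : ∀ n, AEMeasurable (f n) μ)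
    (h : ∀ x, Tendsto (fun n => f n x) atTop (𝓝 (g x))) (hc : ∀ n, ∫⁻ x, f n x ∂μ ≤ c) :
    ∫⁻ x, g x ∂μ ≤ c := by
  calc _ = ∫⁻ x, liminf (fun n => f n x) atTop ∂μ :=
        lintegral_congr fun x => (h x).liminf_eq.symm
    _ ≤ liminf (fun n => ∫⁻ x, f n x ∂μ) atTop := lintegral_liminf_le' hf
    _ ≤ c := liminf_le_of_le (by isBoundedDefault) fun b hb => by
        obtain ⟨n, hn⟩ := hb.exists
        exact hn.trans (hc n)

namespace IsNodalRegion

variable {W : Set R2} {p : ℝ} {u : R2 → ℝ}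

lemma lintegral_rpow_le_lintegral_fderiv (h : IsNodalRegion W p u) (hp : 1 < p) :
    ∫⁻ x in W, ‖u x‖ₑ ^ (p + 1) ≤ ∫⁻ x in W, ENNReal.ofReal (‖fderiv ℝ u x‖ ^ 2) := by
  have huc : ContinuousOn u W := h.contDiffOn.continuousOn
  refine lintegral_le_of_tendsto (f := fun n x =>
    ENNReal.ofReal (softTrunc (1 / ((n : ℝ) + 1)) (u x) * (|u x| ^ (p - 1) * u x)))
    (fun n => ?_) (fun x => ?_) fun n => ?_
  · refine (ContinuousOn.aemeasurable ?_ h.isOpen.measurableSet).ennreal_ofReal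
    exact ((contDiff_softTrunc _).continuous.comp_continuousOn huc).mul
      ((huc.abs.rpow_const fun x _ => Or.inr (by linarith)).mul huc)
  · rw [enorm_rpow_eq_ofReal (by linarith)]
    refine ENNReal.tendsto_ofReal ?_
    simp_rw [softTrunc_mul_rpow_mul]
    rw [← abs_rpow_mul_sq hp]
    exact ((tendsto_softTrunc (fun n => by positivity) tendsto_one_div_add_atTop_nhds_zero_nat
      (abs_nonneg _)).mul_const _).const_mul _
  · rw [← h.lintegral_softTruncDeriv_mul hp (by positivity)]
    refine lintegral_mono fun x => ENNReal.ofReal_le_ofReal ?_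
    exact mul_le_of_le_one_left (sq_nonneg _) (softTruncDeriv_le_one _ _)

lemma lintegral_fderiv_indicator_le (h : IsNodalRegion W p u) (hp : 1 < p) {ε : ℝ}
    (hε : 0 < ε) :
    ∫⁻ x, ‖fderiv ℝ (W.indicator fun x => softTrunc ε (u x)) x‖ₑ ^ 2 ≤
      ∫⁻ x in W, ‖u x‖ₑ ^ (p + 1) := by
  calc _ = ∫⁻ x in W, ‖softTruncDeriv ε (u x) • fderiv ℝ u x‖ₑ ^ 2 := by
        rw [← lintegral_indicator h.isOpen.measurableSet]
        refine lintegral_congr fun x => ?_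
        rw [fderiv_indicator h.isOpen (h.isCompact ε hε) (fun x hx => hx.1)
          (softTrunc_eq_zero hε)]
        by_cases hx : x ∈ W
        · rw [indicator_of_mem hx, indicator_of_mem hx, (h.hasFDerivAt_softTrunc ε hx).fderiv]
        · rw [indicator_of_notMem hx, indicator_of_notMem hx, ← ofReal_norm, norm_zero]
          simp
    _ ≤ ∫⁻ x in W, ENNReal.ofReal (softTruncDeriv ε (u x) * ‖fderiv ℝ u x‖ ^ 2) := by
        refine lintegral_mono fun x => ?_
        simp only
        rw [← ofReal_norm, ← ENNReal.ofReal_pow (norm_nonneg _), norm_smul, mul_pow,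
          Real.norm_of_nonneg (softTruncDeriv_nonneg _ _)]
        refine ENNReal.ofReal_le_ofReal (mul_le_mul_of_nonneg_right ?_ (sq_nonneg _))
        have h0 := softTruncDeriv_nonneg ε (u x)
        have h1 := softTruncDeriv_le_one ε (u x)
        nlinarith
    _ = _ := h.lintegral_softTruncDeriv_mul hp hε
    _ ≤ _ := by
        refine lintegral_mono fun x => ?_
        simp only
        rw [enorm_rpow_eq_ofReal (by linarith), softTrunc_mul_rpow_mul, ← abs_rpow_mul_sq hp]
        refine ENNReal.ofReal_le_ofReal ?_
        gcongr
        exact softTrunc_le ε (abs_nonneg _)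

/-- A region carrying little energy violates the Sobolev inequality. -/
lemma const_le_of_lintegral_le (h : IsNodalRegion W p u) (hp : 2 < p) {R : ℝ}
    (hR : ∀ x ∈ W, ∀ y ∈ W, dist x y < R) (h0 : ∫⁻ x in W, ‖u x‖ₑ ^ (p + 1) ≠ 0)
    (hI : ∫⁻ x in W, ‖u x‖ₑ ^ (p + 1) ≤ ENNReal.ofReal (6 * π * Real.exp 1 / p)) :
    2 / ((p - 1) * p * (p + 1)) ≤
      R ^ 2 * (3 / 4) ^ ((p - 2) / 2) * (√(π / (4 / (3 * Real.exp 1))) / 2) := by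
  set I := ∫⁻ x in W, ‖u x‖ₑ ^ (p + 1) with hIdef
  have hItop : I ≠ ⊤ := (hI.trans_lt ENNReal.ofReal_lt_top).ne
  have hG : 0 < I.toReal := ENNReal.toReal_pos h0 hItop
  have hGI : ENNReal.ofReal I.toReal = I := ENNReal.ofReal_toReal hItop
  have hGp : I.toReal ≤ 6 * π * Real.exp 1 / p :=
    ENNReal.toReal_le_of_le_ofReal (by positivity) hI
  have huc : ContinuousOn u W := h.contDiffOn.continuousOn
  have hlim : ∫⁻ x in W, ENNReal.ofReal (2 / ((p - 1) * p * (p + 1))) * ‖u x‖ₑ ^ (p + 1) ≤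
      ENNReal.ofReal (R ^ 2 * (3 / 4) ^ ((p - 2) / 2) *
        (√(π / (4 / (3 * Real.exp 1))) / 2)) * I := by
    refine lintegral_le_of_tendsto (f := fun n x =>
      ENNReal.ofReal (2 / ((p - 1) * p * (p + 1))) *
        ‖softTrunc (1 / ((n : ℝ) + 1)) (u x)‖ₑ ^ (p + 1)) (fun n => ?_) (fun x => ?_) fun n => ?_
    · refine (AEMeasurable.pow_const ?_ _).const_mul _
      exact (((contDiff_softTrunc _).continuous.comp_continuousOn huc).aemeasurable
        h.isOpen.measurableSet).enorm
    · refine ENNReal.Tendsto.const_mul ?_ (Or.inr ENNReal.ofReal_ne_top)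
      refine (ENNReal.continuous_rpow_const.tendsto _).comp ?_
      simp_rw [← ofReal_norm, Real.norm_eq_abs, abs_softTrunc]
      exact ENNReal.tendsto_ofReal (tendsto_softTrunc (fun n => by positivity)
        tendsto_one_div_add_atTop_nhds_zero_nat (abs_nonneg _))
    · set ε : ℝ := 1 / ((n : ℝ) + 1) with hεdef
      have hε : 0 < ε := by positivity
      have hK := h.isCompact ε hε
      have hKW : {x ∈ W | ε ≤ |u x|} ⊆ W := fun x hx => hx.1
      have hz := softTrunc_eq_zero (W := W) (u := u) hε
      have hts := (tsupport_indicator_subset hK hz).trans hKW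
      have hmain := mul_lintegral_rpow_le_of_le
        (contDiff_indicator (n := 1) h.isOpen hK hKW hz (h.contDiffOn_softTrunc ε))
        (hasCompactSupport_indicator hK hz) (fun x hx y hy => hR x (hts hx) y (hts hy)) hG
        ((h.lintegral_fderiv_indicator_le (by linarith) hε).trans hGI.ge) hp hGp
      rw [hGI] at hmain
      rw [lintegral_const_mul' _ _ ENNReal.ofReal_ne_top]
      refine le_trans (le_of_eq ?_) hmain
      rw [← lintegral_indicator h.isOpen.measurableSet]
      congr 1
      refine lintegral_congr fun x => ?_
      by_cases hx : x ∈ W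
      · simp [hx]
      · simp [hx, ENNReal.zero_rpow_of_pos (by linarith : 0 < p + 1)]
  rw [lintegral_const_mul' _ _ ENNReal.ofReal_ne_top, ENNReal.mul_le_mul_iff_left h0 hItop] at hlim
  exact (ENNReal.ofReal_le_ofReal_iff (by positivity)).1 hlim

end IsNodalRegion

lemma eventually_mul_rpow_lt (B : ℝ) :
    ∀ᶠ p : ℝ in atTop, B * (3 / 4) ^ ((p - 2) / 2) < 2 / ((p - 1) * p * (p + 1)) := by
  have hl : 0 < -Real.log (3 / 4) / 2 := by
    have := Real.log_neg (by norm_num : (0 : ℝ) < 3 / 4) (by norm_num)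
    linarith
  have h1 := (tendsto_rpow_mul_exp_neg_mul_atTop_nhds_zero 3 _ hl).const_mul (|B| * (4 / 3) * 2)
  rw [mul_zero] at h1
  filter_upwards [h1.eventually (gt_mem_nhds (by norm_num : (0 : ℝ) < 2)), eventually_gt_atTop 2]
    with p hp hp2
  have hpos : 0 < (p - 1) * p * (p + 1) := by
    have : 0 < p - 1 := by linarith
    positivity
  rw [lt_div_iff₀ hpos]
  have e : (3 / 4 : ℝ) ^ ((p - 2) / 2) =
      4 / 3 * Real.exp (-(-Real.log (3 / 4) / 2) * p) := by
    rw [Real.rpow_def_of_pos (by norm_num), ← Real.exp_log (by norm_num : (0 : ℝ) < 4 / 3),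
      ← Real.exp_add]
    have : Real.log (4 / 3) = -Real.log (3 / 4) := by rw [← Real.log_inv]; norm_num
    rw [this]
    congr 1; ring
  rw [e]
  have h3 : p ^ (3 : ℝ) = p ^ 3 := by norm_cast
  rw [h3] at hp
  have h4 : (p - 1) * p * (p + 1) ≤ p ^ 3 := by nlinarith
  set E := Real.exp (-(-Real.log (3 / 4) / 2) * p) with hE
  have hE0 : 0 < E := Real.exp_pos _
  calc B * (4 / 3 * E) * ((p - 1) * p * (p + 1))
      ≤ |B| * (4 / 3 * E) * p ^ 3 := by
        gcongr
        exact le_abs_self B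
    _ ≤ |B| * (4 / 3) * 2 * (p ^ 3 * E) := by
        have : 0 ≤ |B| * (4 / 3) * (p ^ 3 * E) := by positivity
        linarith
    _ < 2 := hp

section Region

variable {Ω : Set R2} {p : ℝ} {u : R2 → ℝ}

lemma IsSolution.isNodalRegion (hop : IsOpen Ω) (hbdd : Bornology.IsBounded Ω)
    (h : IsSolution Ω p u) : IsNodalRegion Ω p u := by
  obtain ⟨h2, h1, heq, hbd⟩ := h
  refine ⟨hop, h2, heq, fun ε hε => ?_⟩
  have e : {x ∈ Ω | ε ≤ |u x|} = closure Ω ∩ (fun x => |u x|) ⁻¹' Ici ε := by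
    ext x
    refine ⟨fun hx => ⟨subset_closure hx.1, hx.2⟩, fun hx => ⟨?_, hx.2⟩⟩
    by_contra hxΩ
    have hx0 := hbd x ⟨hx.1, by rwa [hop.interior_eq]⟩
    have : ε ≤ |u x| := hx.2
    rw [hx0, abs_zero] at this
    linarith
  refine Metric.isCompact_of_isClosed_isBounded ?_ (hbdd.subset fun x hx => hx.1)
  rw [e]
  exact h1.continuousOn.abs.preimage_isClosed_of_isClosed isClosed_closure isClosed_Ici

lemma isOpen_nonzero_set (h : IsNodalRegion Ω p u) : IsOpen {y ∈ Ω | u y ≠ 0} :=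
  h.contDiffOn.continuousOn.isOpen_inter_preimage h.isOpen isOpen_ne

/-- The restriction of a nodal region to one of its nodal domains. -/
lemma IsNodalRegion.connectedComponentIn (h : IsNodalRegion Ω p u) (x : R2) :
    IsNodalRegion (connectedComponentIn {y ∈ Ω | u y ≠ 0} x) p u := by
  set N := {y ∈ Ω | u y ≠ 0}
  have hN := isOpen_nonzero_set h
  have hsub : _root_.connectedComponentIn N x ⊆ Ω :=
    (connectedComponentIn_subset N x).trans fun y hy => hy.1
  refine ⟨hN.connectedComponentIn, h.contDiffOn.mono hsub, fun y hy => h.equation y (hsub hy),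
    fun ε hε => ?_⟩
  have e : {y ∈ _root_.connectedComponentIn N x | ε ≤ |u y|} = {y ∈ Ω | ε ≤ |u y|} \
      ⋃ z ∈ N \ _root_.connectedComponentIn N x, _root_.connectedComponentIn N z := by
    ext y
    constructor
    · rintro ⟨hy, hyε⟩
      refine ⟨⟨hsub hy, hyε⟩, fun hyU => ?_⟩
      obtain ⟨z, hz, hyz⟩ := mem_iUnion₂.1 hyU
      apply hz.2
      rw [connectedComponentIn_eq hy, ← connectedComponentIn_eq hyz]
      exact mem_connectedComponentIn hz.1
    · rintro ⟨⟨hyΩ, hyε⟩, hyU⟩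
      have hyN : y ∈ N := ⟨hyΩ, fun h0 => by rw [h0, abs_zero] at hyε; linarith⟩
      refine ⟨?_, hyε⟩
      by_contra hyC
      exact hyU (mem_iUnion₂.2 ⟨y, ⟨hyN, hyC⟩, mem_connectedComponentIn hyN⟩)
  rw [e]
  exact (h.isCompact ε hε).diff (isOpen_biUnion fun z _ => hN.connectedComponentIn)

lemma IsNodalRegion.lintegral_ne_zero (h : IsNodalRegion Ω p u) (hp : 0 < p)
    (hne : Ω.Nonempty) (h0 : ∀ x ∈ Ω, u x ≠ 0) : ∫⁻ x in Ω, ‖u x‖ₑ ^ (p + 1) ≠ 0 := by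
  intro hI
  rw [lintegral_eq_zero_iff' ((h.contDiffOn.continuousOn.aemeasurable
    h.isOpen.measurableSet).enorm.pow_const _)] at hI
  have : ∀ᵐ x ∂(volume.restrict Ω), False := by
    filter_upwards [hI, ae_restrict_mem h.isOpen.measurableSet] with x hx hxΩ
    have hx' : ‖u x‖ₑ ^ (p + 1) = 0 := hx
    rw [ENNReal.rpow_eq_zero_iff_of_pos (by linarith), enorm_eq_zero] at hx'
    exact h0 x hxΩ hx'
  rw [eventually_false_iff_eq_bot, ae_eq_bot, Measure.restrict_eq_zero] at this
  exact (h.isOpen.measure_pos volume hne).ne' this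

lemma connectedComponentIn_ne_of_pos_of_neg (hu : ContinuousOn u Ω) {x y : R2} (hx : x ∈ Ω)
    (hux : 0 < u x) (hy : y ∈ Ω) (huy : u y < 0) :
    connectedComponentIn {y ∈ Ω | u y ≠ 0} x ≠ connectedComponentIn {y ∈ Ω | u y ≠ 0} y := by
  intro he
  have hxC := mem_connectedComponentIn (F := {y ∈ Ω | u y ≠ 0}) ⟨hx, hux.ne'⟩
  have hyC := mem_connectedComponentIn (F := {y ∈ Ω | u y ≠ 0}) ⟨hy, huy.ne⟩
  rw [← he] at hyC
  have hsub := connectedComponentIn_subset {y ∈ Ω | u y ≠ 0} x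
  obtain ⟨z, hz, hz0⟩ := isPreconnected_connectedComponentIn.intermediate_value hyC hxC
    (hu.mono (hsub.trans fun y hy => hy.1)) ⟨huy.le, hux.le⟩
  exact (hsub hz).2 hz0

lemma disjoint_connectedComponentIn {N : Set R2} {x y : R2}
    (h : connectedComponentIn N x ≠ connectedComponentIn N y) :
    Disjoint (connectedComponentIn N x) (connectedComponentIn N y) :=
  disjoint_left.2 fun _ hx hy =>
    h ((connectedComponentIn_eq hx).trans (connectedComponentIn_eq hy).symm)

end Region

lemma add_add_setLIntegral_le {A B C D : Set R2} (hB : MeasurableSet B)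
    (hC : MeasurableSet C) (hAB : Disjoint A B) (hAC : Disjoint A C) (hBC : Disjoint B C)
    (hAD : A ⊆ D) (hBD : B ⊆ D) (hCD : C ⊆ D) (f : R2 → ℝ≥0∞) :
    (∫⁻ x in A, f x) + (∫⁻ x in B, f x) + (∫⁻ x in C, f x) ≤ ∫⁻ x in D, f x := by
  rw [← lintegral_union hB hAB, ← lintegral_union hC (hAC.union_left hBC)]
  exact lintegral_mono_set (union_subset (union_subset hAD hBD) hCD)

theorem stmt3
    (Ω : Set R2) (hne : Ω.Nonempty) (hop : IsOpen Ω)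
    (hbdd : Bornology.IsBounded Ω) (hconn : IsConnected Ω) (hsm : SmoothBoundary Ω)
    (u : ℝ → R2 → ℝ)
    (hsol : ∀ p > (1:ℝ), IsSolution Ω p (u p))
    (hnod : ∀ p > (1:ℝ), IsNodal Ω (u p))
    (hA : CondA Ω u) :
    ∃ pbar : ℝ, ∀ p ≥ pbar,
      {C : Set R2 | ∃ x ∈ {y ∈ Ω | u p y ≠ 0},
        C = connectedComponentIn {y ∈ Ω | u p y ≠ 0} x}.ncard = 2 := by
  obtain ⟨R, hR⟩ : ∃ R : ℝ, ∀ x ∈ Ω, ∀ y ∈ Ω, dist x y < R := ⟨diam Ω + 1, fun x hx y hy =>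
    (dist_le_diam_of_mem hbdd hx hy).trans_lt (lt_add_one _)⟩
  have hlow := eventually_mul_rpow_lt (R ^ 2 * (√(π / (4 / (3 * Real.exp 1))) / 2))
  have he := Real.exp_pos 1
  have hpos : 0 < π * Real.exp 1 := by positivity
  have hup := hA.eventually (Ioo_mem_nhds (a := 0) (b := 18 * π * Real.exp 1)
    (by linarith) (by linarith))
  obtain ⟨pbar, hpbar⟩ := eventually_atTop.1 ((hlow.and hup).and (eventually_gt_atTop 2))
  refine ⟨pbar, fun p hp => ?_⟩
  obtain ⟨⟨hc, hE0, hE⟩, hp2⟩ := hpbar p hp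
  have hΩ := (hsol p (by linarith)).isNodalRegion hop hbdd
  obtain ⟨⟨a, ha, hua⟩, ⟨b, hb, hub⟩⟩ := hnod p (by linarith)
  set N := {y ∈ Ω | u p y ≠ 0}
  have hNΩ : ∀ x, connectedComponentIn N x ⊆ Ω := fun x =>
    (connectedComponentIn_subset N x).trans fun y hy => hy.1
  have hab := connectedComponentIn_ne_of_pos_of_neg hΩ.contDiffOn.continuousOn ha hua hb hub
  have hbig : ∀ x ∈ N, ENNReal.ofReal (6 * π * Real.exp 1 / p) ≤
      ∫⁻ y in connectedComponentIn N x, ‖u p y‖ₑ ^ (p + 1) := by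
    intro x hx
    by_contra! hlt
    have hC := hΩ.connectedComponentIn x
    refine hc.not_ge ?_
    refine (hC.const_le_of_lintegral_le hp2 (fun y hy z hz => hR y (hNΩ x hy) z (hNΩ x hz))
      (hC.lintegral_ne_zero (by linarith) ⟨x, mem_connectedComponentIn hx⟩
        fun y hy => (connectedComponentIn_subset N x hy).2) hlt.le).trans (le_of_eq (by ring))
  have htot : ∫⁻ x in Ω, ‖u p x‖ₑ ^ (p + 1) < ENNReal.ofReal (18 * π * Real.exp 1 / p) := by
    have hg : ∀ x, ‖gradient (u p) x‖ = ‖fderiv ℝ (u p) x‖ := fun x => by simp [gradient]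
    simp only [hg] at hE0 hE
    have hint : IntegrableOn (fun x => ‖fderiv ℝ (u p) x‖ ^ 2) Ω := by
      by_contra hni
      rw [integral_undef hni, mul_zero] at hE0
      exact lt_irrefl _ hE0
    refine (hΩ.lintegral_rpow_le_lintegral_fderiv (by linarith)).trans_lt ?_
    rw [← ofReal_integral_eq_lintegral_ofReal hint (ae_of_all _ fun x => sq_nonneg _)]
    rw [ENNReal.ofReal_lt_ofReal_iff (by positivity), lt_div_iff₀ (by linarith), mul_comm]
    exact hE
  have hset : {C : Set R2 | ∃ x ∈ N, C = connectedComponentIn N x} =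
      {connectedComponentIn N a, connectedComponentIn N b} := by
    ext C
    constructor
    · rintro ⟨x, hx, rfl⟩
      by_contra hnot
      rw [mem_insert_iff, mem_singleton_iff, not_or] at hnot
      have hm : ∀ y, MeasurableSet (connectedComponentIn N y) := fun y =>
        (hΩ.connectedComponentIn y).isOpen.measurableSet
      have hsum := add_add_setLIntegral_le (hm b) (hm x) (disjoint_connectedComponentIn hab)
        (disjoint_connectedComponentIn (Ne.symm hnot.1))
        (disjoint_connectedComponentIn (Ne.symm hnot.2)) (hNΩ a) (hNΩ b) (hNΩ x)
        fun y => ‖u p y‖ₑ ^ (p + 1)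
      have hlt := (add_le_add (add_le_add (hbig a ⟨ha, hua.ne'⟩) (hbig b ⟨hb, hub.ne⟩))
        (hbig x hx)).trans_lt (hsum.trans_lt htot)
      rw [← ENNReal.ofReal_add (by positivity) (by positivity),
        ← ENNReal.ofReal_add (by positivity) (by positivity),
        ENNReal.ofReal_lt_ofReal_iff (by positivity)] at hlt
      refine hlt.ne ?_
      ring
    · rintro (rfl | rfl)
      · exact ⟨a, ⟨ha, hua.ne'⟩, rfl⟩
      · exact ⟨b, ⟨hb, hub.ne⟩, rfl⟩
  rw [hset, ncard_pair hab]
end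
end
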